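/- arXiv:2605.20949 — 6 statements merged into one kernel-verified Lean document; each statement's English description precedes it below -/
import Mathlib

section
/- Let r ≥ 2, let F be an r-graph with e(F) ≥ 2, and let δ > 0. Then there exists α = α(F,δ) > 0 such that for every n ≥ α there exist a collection 𝒮 of r-graphs on the vertex set [n] (sources) and a collection 𝒞 = {C(S) : S ∈ 𝒮} of r-graphs on the vertex set [n] (containers) such that: (a) every S ∈ 𝒮 satisfies e(S) ≤ α·n^{r−1/m_r(F)}; (b) every C ∈ 𝒞 contains fewer than δ·n^{v(F)} copies of F; (c) for every F-free r-graph G on vertex set [n] there exists S ∈ 𝒮 with S ⊆ G ⊆ C(S). -/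
open Finset

/-- An `r`-uniform hypergraph with vertices in `ℕ`. -/
structure HGraph (r : ℕ) where
  verts : Finset ℕ
  edges : Finset (Finset ℕ)
  edge_sub : ∀ e ∈ edges, e ⊆ verts
  edge_card : ∀ e ∈ edges, e.card = r

/-- The complete `r`-graph `K_t^{(r)}` on vertex set `{0, …, t-1}`. -/
def completeHG (r t : ℕ) : HGraph r where
  verts := Finset.range t
  edges := (Finset.range t).powersetCard r
  edge_sub := fun _ he => (Finset.mem_powersetCard.mp he).1
  edge_card := fun _ he => (Finset.mem_powersetCard.mp he).2

/-- There is a copy of `F` in `G` all of whose edges satisfy `Q`. -/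
def HasCopyWith {r : ℕ} (F G : HGraph r) (Q : Finset ℕ → Prop) : Prop :=
  ∃ φ : ℕ → ℕ, Set.InjOn φ ↑F.verts ∧ (∀ v ∈ F.verts, φ v ∈ G.verts) ∧
    ∀ e ∈ F.edges, e.image φ ∈ G.edges ∧ Q (e.image φ)

/-- There is a copy of `F` in `G`. -/
def HasCopy {r : ℕ} (F G : HGraph r) : Prop := HasCopyWith F G fun _ => True

/-- `G → (F 0, …, F (l-1))`: every `l`-coloring of the edges of `G` yields a copy of
`F i` that is monochromatic in color `i`, for some `i`. -/
def ArrowsList {r : ℕ} (G : HGraph r) (l : ℕ) (F : Fin l → HGraph r) : Prop :=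
  ∀ c : Finset ℕ → Fin l, ∃ i : Fin l, HasCopyWith (F i) G fun e => c e = i

/-- `G → (F₁, F₂)`: every red-blue (`true`/`false`) coloring of the edges of `G` yields
a red copy of `F₁` or a blue copy of `F₂`. -/
def Arrows2 {r : ℕ} (G F1 F2 : HGraph r) : Prop :=
  ∀ c : Finset ℕ → Bool,
    HasCopyWith F1 G (fun e => c e = true) ∨ HasCopyWith F2 G (fun e => c e = false)

/-- The Ramsey number `R(F 0, …, F (l-1))`. -/
noncomputable def ramseyList (r l : ℕ) (F : Fin l → HGraph r) : ℕ :=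
  sInf {n | ∃ G : HGraph r, G.verts.card = n ∧ ArrowsList G l F}

/-- The two-color Ramsey number `R(F₁, F₂)`. -/
noncomputable def ramsey2 (r : ℕ) (F1 F2 : HGraph r) : ℕ :=
  sInf {n | ∃ G : HGraph r, G.verts.card = n ∧ Arrows2 G F1 F2}

/-- `J` is a subgraph of `F`. -/
def HGSub {r : ℕ} (J F : HGraph r) : Prop := J.verts ⊆ F.verts ∧ J.edges ⊆ F.edges

/-- The maximum `r`-density `m_r(F)`. -/
noncomputable def mDensity (r : ℕ) (F : HGraph r) : ℝ :=
  if F.edges.card = 0 then 0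
  else if F.edges.card = 1 then 1 / r
  else sSup {x : ℝ | ∃ J : HGraph r, HGSub J F ∧ r < J.verts.card ∧
    x = ((J.edges.card : ℝ) - 1) / ((J.verts.card : ℝ) - (r : ℝ))}

/-- The primal `r`-graph `G[H,r]` of an `s`-graph `H`. -/
def primal (r : ℕ) {s : ℕ} (H : HGraph s) : HGraph r where
  verts := H.verts
  edges := H.edges.biUnion fun A => A.powersetCard r
  edge_sub := by
    intro e he
    obtain ⟨A, hA, heA⟩ := Finset.mem_biUnion.mp he
    exact (Finset.mem_powersetCard.mp heA).1.trans (H.edge_sub A hA)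
  edge_card := by
    intro e he
    obtain ⟨A, hA, heA⟩ := Finset.mem_biUnion.mp he
    exact (Finset.mem_powersetCard.mp heA).2

/-- `H` is `r`-linear: every `r`-set of vertices lies in at most one edge. -/
def RLinear (r : ℕ) {s : ℕ} (H : HGraph s) : Prop :=
  ∀ A ∈ H.edges, ∀ B ∈ H.edges, ∀ e : Finset ℕ, e.card = r → e ⊆ A → e ⊆ B → A = B

/-- `H` is `(r,t)`-conformal: every `t`-set of vertices spanning a clique in the primal
`r`-graph is contained in an edge of `H`. -/
def HGConformal (r t : ℕ) {s : ℕ} (H : HGraph s) : Prop :=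
  ∀ W : Finset ℕ, W ⊆ H.verts → W.card = t →
    (∀ B ∈ W.powersetCard r, B ∈ (primal r H).edges) → ∃ A ∈ H.edges, W ⊆ A

/-- `E` is an `r`-cover of `W`: every `r`-subset of `W` lies in a member of `E`. -/
def IsRCover (r : ℕ) (W : Finset ℕ) (E : Finset (Finset ℕ)) : Prop :=
  ∀ B ∈ W.powersetCard r, ∃ A ∈ E, B ⊆ A

/-- `E` is a minimal non-trivial `r`-cover of `W`. -/
def MinNontrivCover (r : ℕ) (W : Finset ℕ) (E : Finset (Finset ℕ)) : Prop :=
  IsRCover r W E ∧ E.card ≠ 1 ∧ ∀ E' ⊂ E, ¬ IsRCover r W E'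

/-- `S ⊑ H`: there are `e(S)` distinct edges of `H`, one containing each edge of `S`. -/
def SqSub {r s : ℕ} (S : HGraph r) (H : HGraph s) : Prop :=
  ∃ f : Finset ℕ → Finset ℕ, Set.InjOn f ↑S.edges ∧
    ∀ e ∈ S.edges, f e ∈ H.edges ∧ e ⊆ f e

/-- The number of (labeled) copies of `F` in `G` all of whose edges satisfy `Q`. -/
noncomputable def copyCountWith {r : ℕ} (F G : HGraph r) (Q : Finset ℕ → Prop) : ℕ :=
  Set.ncard { φ : ℕ → ℕ | (∀ v, v ∉ F.verts → φ v = 0) ∧ Set.InjOn φ ↑F.verts ∧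
    (∀ v ∈ F.verts, φ v ∈ G.verts) ∧ ∀ e ∈ F.edges, e.image φ ∈ G.edges ∧ Q (e.image φ) }

/-- The number of (labeled) copies of `F` in `G`. -/
noncomputable def copyCount {r : ℕ} (F G : HGraph r) : ℕ :=
  copyCountWith F G fun _ => True


/-- Every member `I` of `𝓘` has a fingerprint `S I ⊆ I` of size at most `s` and a container
`C I ⊇ I` satisfying `Q`, such that mutually compatible fingerprints have the same container. -/
def HasContainers {α : Type*} (𝓘 : Set (Finset α)) (s : ℕ) (Q : Finset α → Prop) : Prop :=
  ∃ S C : Finset α → Finset α,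
    (∀ I ∈ 𝓘, S I ⊆ I ∧ (S I).card ≤ s ∧ I ⊆ C I ∧ Q (C I)) ∧
    ∀ I ∈ 𝓘, ∀ I' ∈ 𝓘, S I ⊆ I' → S I' ⊆ I → C I = C I'

namespace HasContainers

variable {α : Type*} {𝓘 𝓙 : Set (Finset α)} {s t : ℕ} {Q R : Finset α → Prop}

theorem mono (h : HasContainers 𝓙 s Q) (h𝓘 : 𝓘 ⊆ 𝓙) (hs : s ≤ t) : HasContainers 𝓘 t Q := by
  obtain ⟨S, C, h1, h2⟩ := h
  refine ⟨S, C, fun I hI => ?_, fun I hI I' hI' => h2 I (h𝓘 hI) I' (h𝓘 hI')⟩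
  obtain ⟨a, b, c, d⟩ := h1 I (h𝓘 hI)
  exact ⟨a, b.trans hs, c, d⟩

theorem imp (h : HasContainers 𝓘 s R) (hQ : ∀ X, R X → Q X) : HasContainers 𝓘 s Q := by
  obtain ⟨S, C, h1, h2⟩ := h
  refine ⟨S, C, fun I hI => ?_, h2⟩
  obtain ⟨a, b, c, d⟩ := h1 I hI
  exact ⟨a, b, c, hQ _ d⟩

theorem of_subset {X : Finset α} (hX : Q X) (h : ∀ I ∈ 𝓘, I ⊆ X) : HasContainers 𝓘 s Q :=
  ⟨fun _ => ∅, fun _ => X, fun I hI => ⟨empty_subset I, by simp, h I hI, hX⟩,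
    fun _ _ _ _ _ _ => rfl⟩

theorem of_isEmpty (h : ∀ I, I ∉ 𝓘) : HasContainers 𝓘 s Q :=
  ⟨fun _ => ∅, fun _ => ∅, fun I hI => (h I hI).elim, fun I hI => (h I hI).elim⟩

theorem branch [DecidableEq α] (v : α) (h0 : HasContainers {I ∈ 𝓘 | v ∉ I} (s + 1) Q)
    (h1 : HasContainers {I ∈ 𝓘 | v ∈ I} s Q) : HasContainers 𝓘 (s + 1) Q := by
  obtain ⟨S0, C0, h0, h0'⟩ := h0
  obtain ⟨S1, C1, h1, h1'⟩ := h1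
  refine ⟨fun I => if v ∈ I then insert v (S1 I) else S0 I,
    fun I => if v ∈ I then C1 I else C0 I, fun I hI => ?_, fun I hI I' hI' h h' => ?_⟩
  · by_cases hv : v ∈ I
    · obtain ⟨a, b, c, d⟩ := h1 I ⟨hI, hv⟩
      simp only [hv, if_true]
      exact ⟨insert_subset hv a, (card_insert_le _ _).trans (by omega), c, d⟩
    · simpa only [hv, if_false] using h0 I ⟨hI, hv⟩
  · by_cases hv : v ∈ I
    · simp only [hv, if_true] at h h' ⊢
      have hv' : v ∈ I' := h (mem_insert_self _ _)
      simp only [hv', if_true] at h' ⊢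
      exact h1' I ⟨hI, hv⟩ I' ⟨hI', hv'⟩ ((subset_insert _ _).trans h)
        ((subset_insert _ _).trans h')
    · by_cases hv' : v ∈ I'
      · simp only [hv', if_true] at h'
        exact (hv (h' (mem_insert_self _ _))).elim
      · simp only [hv, hv', if_false] at h h' ⊢
        exact h0' I ⟨hI, hv⟩ I' ⟨hI', hv'⟩ h h'

theorem branch_finset [DecidableEq α] (A : Finset α) :
    ∀ {𝓘 : Set (Finset α)}, HasContainers {I ∈ 𝓘 | ∀ v ∈ A, v ∉ I} (s + 1) Q →
      (∀ v ∈ A, HasContainers {I ∈ 𝓘 | v ∈ I} s Q) → HasContainers 𝓘 (s + 1) Q := by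
  induction A using Finset.induction_on with
  | empty => exact fun h0 _ => h0.mono (fun I hI => ⟨hI, by simp⟩) le_rfl
  | insert v A _ ih =>
    intro 𝓘 h0 h1
    refine branch v (ih (h0.mono ?_ le_rfl) fun u hu => ?_) (h1 v (mem_insert_self _ _))
    · rintro I ⟨⟨hI, hv⟩, hA⟩
      refine ⟨hI, fun u hu => ?_⟩
      rcases mem_insert.1 hu with rfl | hu
      exacts [hv, hA u hu]
    · exact (h1 u (mem_insert_of_mem hu)).mono (fun I hI => ⟨hI.1.1, hI.2⟩) le_rfl

theorem comp [DecidableEq α] (h : HasContainers 𝓘 s R)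
    (h' : ∀ X, R X → HasContainers {I ∈ 𝓘 | I ⊆ X} t Q) : HasContainers 𝓘 (s + t) Q := by
  obtain ⟨S, C, h1, h2⟩ := h
  choose! S' C' h1' h2' using h'
  refine ⟨fun I => S I ∪ S' (C I) I, fun I => C' (C I) I, fun I hI => ?_,
    fun I hI I' hI' h h' => ?_⟩
  · obtain ⟨a, b, c, d⟩ := h1 I hI
    obtain ⟨a', b', c', d'⟩ := h1' _ d I ⟨hI, c⟩
    exact ⟨union_subset a a', (card_union_le _ _).trans (by omega), c', d'⟩
  · have hC := h2 I hI I' hI' (subset_union_left.trans h) (subset_union_left.trans h')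
    obtain ⟨-, -, c, d⟩ := h1 I hI
    have c' := (h1 I' hI').2.2.1
    simp only at h h' ⊢
    rw [← hC] at h' c' ⊢
    exact h2' _ d I ⟨hI, c⟩ I' ⟨hI', c'⟩ (subset_union_right.trans h)
      (subset_union_right.trans h')

theorem exists_fun (h : HasContainers 𝓘 s Q) :
    ∃ (𝒮 : Set (Finset α)) (f : Finset α → Finset α),
      (∀ S ∈ 𝒮, S.card ≤ s ∧ Q (f S)) ∧ ∀ I ∈ 𝓘, ∃ S ∈ 𝒮, S ⊆ I ∧ I ⊆ f S := by
  obtain ⟨S, C, h1, h2⟩ := h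
  have key : ∀ T, ∃ X, ∀ I ∈ 𝓘, S I = T → C I = X := by
    intro T
    by_cases hT : ∃ I ∈ 𝓘, S I = T
    · obtain ⟨I, hI, rfl⟩ := hT
      refine ⟨C I, fun I' hI' h => h2 I' hI' I hI ?_ ?_⟩
      · exact h ▸ (h1 I hI).1
      · exact h ▸ (h1 I' hI').1
    · exact ⟨∅, fun I hI h => (hT ⟨I, hI, h⟩).elim⟩
  choose f hf using key
  refine ⟨S '' 𝓘, f, ?_, fun I hI => ⟨S I, ⟨I, hI, rfl⟩, (h1 I hI).1, ?_⟩⟩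
  · rintro _ ⟨I, hI, rfl⟩
    rw [← hf _ I hI rfl]
    exact ⟨(h1 I hI).2.1, (h1 I hI).2.2.2⟩
  · rw [← hf _ I hI rfl]
    exact (h1 I hI).2.2.1

end HasContainers

section WeightedDegree

variable {α : Type*} [DecidableEq α]

/-- The total weight of the `i`-subsets of `X` that contain `T`. -/
def wdeg (X : Finset α) (i : ℕ) (w : Finset α → ℝ) (T : Finset α) : ℝ :=
  ∑ e ∈ X.powersetCard i, if T ⊆ e then w e else 0

variable {X : Finset α} {i : ℕ} {w w' : Finset α → ℝ} {T : Finset α}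

theorem wdeg_nonneg (hw : ∀ e, 0 ≤ w e) : 0 ≤ wdeg X i w T :=
  sum_nonneg fun e _ => by split_ifs; exacts [hw e, le_rfl]

theorem wdeg_mono (hw : ∀ e, w e ≤ w' e) : wdeg X i w T ≤ wdeg X i w' T :=
  sum_le_sum fun e _ => by split_ifs; exacts [hw e, le_rfl]

theorem wdeg_eq_zero (h : ∀ e ∈ X.powersetCard i, T ⊆ e → w e = 0) : wdeg X i w T = 0 :=
  sum_eq_zero fun e he => by split_ifs with hT; exacts [h e he hT, rfl]

theorem wdeg_subset {Y : Finset α} (hw : ∀ e, 0 ≤ w e) (h : Y ⊆ X) :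
    wdeg Y i w T ≤ wdeg X i w T :=
  sum_le_sum_of_subset_of_nonneg (powersetCard_mono h) fun e _ _ => by
    split_ifs; exacts [hw e, le_rfl]

theorem wdeg_div (a : ℝ) : wdeg X i (fun e => w e / a) T = wdeg X i w T / a := by
  simp only [wdeg, sum_div, ite_div, zero_div]

theorem wdeg_add_link {v : α} (hv : v ∈ X) :
    wdeg X i (fun e => w' e + if v ∈ e then 0 else w (insert v e)) T =
      wdeg X i w' T + if v ∈ T then 0 else wdeg X (i + 1) w (insert v T) := by
  have : ∀ e, (if T ⊆ e then w' e + (if v ∈ e then 0 else w (insert v e)) else 0) =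
      (if T ⊆ e then w' e else 0) + if T ⊆ e ∧ v ∉ e then w (insert v e) else 0 := by
    intro e; split_ifs <;> simp_all
  simp only [wdeg, this, sum_add_distrib]
  congr 1
  split_ifs with hT
  · exact sum_eq_zero fun e _ => if_neg fun h => h.2 (h.1 hT)
  · rw [← sum_filter, ← sum_filter]
    refine sum_nbij' (insert v) (fun e => e.erase v) ?_ ?_ ?_ ?_ fun _ _ => rfl
    · intro e he
      simp only [mem_filter, mem_powersetCard] at he ⊢
      refine ⟨⟨insert_subset hv he.1.1, ?_⟩, insert_subset_insert _ he.2.1⟩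
      rw [card_insert_of_notMem he.2.2, he.1.2]
    · intro e he
      simp only [mem_filter, mem_powersetCard, insert_subset_iff] at he ⊢
      refine ⟨⟨(erase_subset _ _).trans he.1.1, ?_⟩, ?_, notMem_erase _ _⟩
      · rw [card_erase_of_mem he.2.1, he.1.2]; rfl
      · exact subset_erase.2 ⟨he.2.2, hT⟩
    · intro e he
      exact erase_insert (mem_filter.1 he).2.2
    · intro e he
      exact insert_erase (insert_subset_iff.1 (mem_filter.1 he).2).1

theorem sum_wdeg_powerset : ∑ T ∈ X.powerset, wdeg X i w T = 2 ^ i * wdeg X i w ∅ := by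
  simp only [wdeg, empty_subset, if_true]
  rw [sum_comm, mul_sum]
  refine sum_congr rfl fun e he => ?_
  rw [mem_powersetCard] at he
  rw [← sum_filter, sum_const, nsmul_eq_mul]
  have : X.powerset.filter (· ⊆ e) = e.powerset := by
    ext T
    simp only [mem_filter, mem_powerset]
    exact ⟨fun h => h.2, fun h => ⟨h.trans he.1, h⟩⟩
  rw [this, card_powerset, he.2]
  push_cast
  rfl

theorem wdeg_empty_le_sum_singleton (hw : ∀ e, 0 ≤ w e) :
    wdeg X (i + 1) w ∅ ≤ ∑ v ∈ X, wdeg X (i + 1) w {v} := by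
  simp only [wdeg, empty_subset, if_true]
  rw [sum_comm]
  refine sum_le_sum fun e he => ?_
  rw [mem_powersetCard] at he
  obtain ⟨v, hv⟩ : e.Nonempty := card_pos.1 (by omega)
  refine le_trans (le_of_eq ?_) (single_le_sum (f := fun v => if {v} ⊆ e then w e else 0)
    (fun u _ => ?_) (he.1 hv))
  · simp [hv]
  · split_ifs
    exacts [hw e, le_rfl]

end WeightedDegree

section ContainerStep

variable {α : Type*} [DecidableEq α]

theorem wdeg_eq_zero_of_not_subset {X : Finset α} {i : ℕ} {w : Finset α → ℝ} {T : Finset α}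
    (h : ¬ T ⊆ X) : wdeg X i w T = 0 :=
  wdeg_eq_zero fun _ he hT => (h (hT.trans (mem_powersetCard.1 he).1)).elim

/-- The nonempty subsets of `X` whose degree is larger than `K * τ ^ #T`. -/
noncomputable def saturated (X : Finset α) (i : ℕ) (K τ : ℝ) (w : Finset α → ℝ) :
    Finset (Finset α) :=
  X.powerset.filter fun T => T.Nonempty ∧ K * τ ^ T.card < wdeg X i w T

theorem wdeg_le_of_notMem_saturated {X : Finset α} {i : ℕ} {K τ : ℝ} {w : Finset α → ℝ}
    {T : Finset α} (hK : 0 ≤ K) (hτ : 0 ≤ τ) (hT : T.Nonempty) (h : T ∉ saturated X i K τ w) :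
    wdeg X i w T ≤ K * τ ^ T.card := by
  by_cases hX : T ⊆ X
  · by_contra! h'
    exact h (mem_filter.2 ⟨mem_powerset.2 hX, hT, h'⟩)
  · rw [wdeg_eq_zero_of_not_subset hX]
    positivity

theorem sum_saturated_le {X : Finset α} {i : ℕ} {K τ : ℝ} {w : Finset α → ℝ}
    (hw : ∀ e, 0 ≤ w e) :
    ∑ T ∈ saturated X i K τ w, K * τ ^ T.card ≤ 2 ^ i * wdeg X i w ∅ := by
  rw [← sum_wdeg_powerset]
  calc ∑ T ∈ saturated X i K τ w, K * τ ^ T.card ≤ ∑ T ∈ saturated X i K τ w, wdeg X i w T :=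
        sum_le_sum fun T hT => (mem_filter.1 hT).2.2.le
    _ ≤ ∑ T ∈ X.powerset, wdeg X i w T :=
        sum_le_sum_of_subset_of_nonneg (filter_subset _ _) fun T _ _ => wdeg_nonneg hw

theorem card_large_degree {X : Finset α} {i : ℕ} {w : Finset α → ℝ} {N K c : ℝ} (hK : 0 < K)
    (hN : 0 ≤ N) (hc : 0 ≤ c) (hc4 : c ≤ 1 / 4) (hX : (X.card : ℝ) ≤ N) (hw : ∀ e, 0 ≤ w e)
    (hdeg : ∀ v ∈ X, wdeg X (i + 1) w {v} ≤ K) (htot : N / 2 ≤ wdeg X (i + 1) w ∅) :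
    ((X.filter fun v => wdeg X (i + 1) w {v} < c).card : ℝ) + 1 / (4 * K) * N ≤ X.card := by
  have h1 := htot.trans (wdeg_empty_le_sum_singleton (X := X) (i := i) hw)
  rw [← sum_filter_add_sum_filter_not X fun v => wdeg X (i + 1) w {v} < c] at h1
  have h2 : ∑ v ∈ X with wdeg X (i + 1) w {v} < c, wdeg X (i + 1) w {v} ≤
      (X.filter fun v => wdeg X (i + 1) w {v} < c).card * c := by
    rw [← nsmul_eq_mul]
    exact sum_le_card_nsmul _ _ _ fun v hv => (mem_filter.1 hv).2.le
  have h3 : ∑ v ∈ X with ¬ wdeg X (i + 1) w {v} < c, wdeg X (i + 1) w {v} ≤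
      (X.filter fun v => ¬ wdeg X (i + 1) w {v} < c).card * K := by
    rw [← nsmul_eq_mul]
    exact sum_le_card_nsmul _ _ _ fun v hv => hdeg v (mem_filter.1 hv).1
  have h4 : ((X.filter fun v => wdeg X (i + 1) w {v} < c).card : ℝ) +
      (X.filter fun v => ¬ wdeg X (i + 1) w {v} < c).card = X.card := by
    exact_mod_cast card_filter_add_card_filter_not (s := X) fun v => wdeg X (i + 1) w {v} < c
  set a : ℝ := ((X.filter fun v => wdeg X (i + 1) w {v} < c).card : ℝ)
  set b : ℝ := ((X.filter fun v => ¬ wdeg X (i + 1) w {v} < c).card : ℝ)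
  have ha0 : 0 ≤ a := Nat.cast_nonneg _
  have hb0 : 0 ≤ b := Nat.cast_nonneg _
  have h5 : a * c ≤ N * (1 / 4) := mul_le_mul (by linarith) hc4 hc hN
  have h6 : N / 4 ≤ b * K := by linarith
  have h7 : 1 / (4 * K) * N ≤ b := by
    rw [div_mul_eq_mul_div, div_le_iff₀ (by positivity)]
    linarith
  linarith

open Classical in
theorem wdeg_empty_le_delete {X : Finset α} {i : ℕ} {w : Finset α → ℝ} (hw : ∀ e, 0 ≤ w e)
    (v : α) (𝒯 : Finset (Finset α)) :
    wdeg X i w ∅ ≤ wdeg X i (fun e => if v ∈ e ∨ ∃ T ∈ 𝒯, T ⊆ e then 0 else w e) ∅ +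
      wdeg X i w {v} + ∑ T ∈ 𝒯, wdeg X i w T := by
  simp only [wdeg, empty_subset, if_true, singleton_subset_iff]
  rw [sum_comm, ← sum_add_distrib, ← sum_add_distrib]
  refine sum_le_sum fun e _ => ?_
  have hs : ∀ T ∈ 𝒯, 0 ≤ if T ⊆ e then w e else 0 :=
    fun T _ => by split_ifs; exacts [hw e, le_rfl]
  by_cases hve : v ∈ e
  · simpa [hve] using sum_nonneg hs
  · by_cases hT : ∃ T ∈ 𝒯, T ⊆ e
    · obtain ⟨T, hT, hTe⟩ := hT
      have h := single_le_sum hs hT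
      rw [if_pos hTe] at h
      rw [if_pos (Or.inr ⟨T, hT, hTe⟩), if_neg hve]
      linarith
    · rw [if_neg (not_or.2 ⟨hve, hT⟩), if_neg hve]
      linarith [sum_nonneg hs]

theorem hasContainers_of_fuel {X : Finset α} {i m : ℕ} {N τ K c : ℝ} {Q : Finset α → Prop}
    (hN : 0 < N) (hτ : 0 < τ) (hτ1 : τ ≤ 1) (hm : (m : ℝ) = τ * N) (hX : (X.card : ℝ) ≤ N)
    (hK : 0 < K) (hc : c * (4 * 2 ^ i) = 1)
    (hQ : ∀ Y ⊆ X, (Y.card : ℝ) + 1 / (4 * K) * N ≤ X.card → Q Y)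
    (ih : ∀ (u : Finset α → ℝ) (𝓘 : Set (Finset α)), (∀ e, 0 ≤ u e) → N ≤ wdeg X i u ∅ →
      (∀ T : Finset α, T.Nonempty → τ * wdeg X i u T ≤ 2 * K / c * τ ^ T.card) →
      (∀ I ∈ 𝓘, I ⊆ X ∧ ∀ e ∈ X.powersetCard i, e ⊆ I → u e = 0) → HasContainers 𝓘 (i * m) Q)
    (t : ℕ) : ∀ (w u : Finset α → ℝ) (𝓘 : Set (Finset α)), (∀ e, 0 ≤ w e) → (∀ e, 0 ≤ u e) →
      c * m ≤ wdeg X i u ∅ + c * t →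
      (∀ T : Finset α, T.Nonempty → τ * wdeg X (i + 1) w T ≤ K * τ ^ T.card) →
      (∀ T : Finset α, T.Nonempty → wdeg X i u T ≤ 2 * K * τ ^ T.card) →
      (∀ T ∈ saturated X i K τ u, ∀ e, T ⊆ e → w e = 0) →
      τ * N ≤ τ * wdeg X (i + 1) w ∅ + τ * wdeg X i u ∅ +
        ∑ T ∈ saturated X i K τ u, K * τ ^ T.card →
      (∀ I ∈ 𝓘, I ⊆ X ∧ (∀ e ∈ X.powersetCard (i + 1), e ⊆ I → w e = 0) ∧
        ∀ e ∈ X.powersetCard i, e ⊆ I → u e = 0) → HasContainers 𝓘 (t + i * m) Q := by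
  have hc0 : 0 < c := by
    by_contra! h
    nlinarith [show (0 : ℝ) < 4 * 2 ^ i by positivity]
  have hc4 : c ≤ 1 / 4 := by
    nlinarith [one_le_pow₀ (n := i) (one_le_two (α := ℝ))]
  have big : ∀ (t : ℕ) (u : Finset α → ℝ) (𝓘 : Set (Finset α)), (∀ e, 0 ≤ u e) →
      c * m ≤ wdeg X i u ∅ →
      (∀ T : Finset α, T.Nonempty → wdeg X i u T ≤ 2 * K * τ ^ T.card) →
      (∀ I ∈ 𝓘, I ⊆ X ∧ ∀ e ∈ X.powersetCard i, e ⊆ I → u e = 0) →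
      HasContainers 𝓘 (t + i * m) Q := by
    intro t u 𝓘 hu hbig hdeg hI
    refine (ih (fun e => u e / (c * τ)) 𝓘 (fun e => div_nonneg (hu e) (by positivity)) ?_ ?_
      fun I h => ⟨(hI I h).1, fun e he heI => ?_⟩).mono subset_rfl (Nat.le_add_left _ _)
    · rw [wdeg_div, le_div_iff₀ (by positivity)]
      calc N * (c * τ) = c * m := by rw [hm]; ring
        _ ≤ _ := hbig
    · intro T hT
      rw [wdeg_div]
      calc τ * (wdeg X i u T / (c * τ)) = wdeg X i u T / c := by field_simp
        _ ≤ 2 * K * τ ^ T.card / c := by gcongr; exact hdeg T hT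
        _ = _ := by ring
    · simp [(hI I h).2 e he heI]
  induction t with
  | zero =>
    intro w u 𝓘 _ hu htot _ hu2 _ _ hI
    exact big 0 u 𝓘 hu (by simpa using htot) hu2 fun I h => ⟨(hI I h).1, (hI I h).2.2⟩
  | succ t iht =>
    intro w u 𝓘 hw hu htot hwdeg hudeg hsat hN' hI
    by_cases hbig : c * m ≤ wdeg X i u ∅
    · exact big _ u 𝓘 hu hbig hudeg fun I h => ⟨(hI I h).1, (hI I h).2.2⟩
    push Not at hbig
    rw [show t + 1 + i * m = t + i * m + 1 by ring]
    refine HasContainers.branch_finset (X.filter fun v => ¬ wdeg X (i + 1) w {v} < c) ?_ ?_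
    · refine HasContainers.of_subset (X := X.filter fun v => wdeg X (i + 1) w {v} < c)
        (hQ _ (filter_subset _ _) ?_) ?_
      · refine card_large_degree hK hN.le hc0.le hc4 hX hw (fun v _ => ?_) ?_
        · have := hwdeg {v} (singleton_nonempty v)
          rw [card_singleton, pow_one, mul_comm] at this
          exact le_of_mul_le_mul_right this hτ
        · have h1 := sum_saturated_le (X := X) (i := i) (K := K) (τ := τ) hu
          have h2 : 2 ^ i * wdeg X i u ∅ ≤ τ * (N / 4) := by
            calc 2 ^ i * wdeg X i u ∅ ≤ 2 ^ i * (c * m) := by gcongr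
              _ = c * (4 * 2 ^ i) * (τ * (N / 4)) := by rw [hm]; ring
              _ = _ := by rw [hc, one_mul]
          have h3 : wdeg X i u ∅ ≤ N / 4 := by
            refine hbig.le.trans ?_
            rw [hm]
            calc c * (τ * N) ≤ 1 / 4 * (1 * N) := by gcongr
              _ = _ := by ring
          have h4 : τ * wdeg X i u ∅ ≤ τ * (N / 4) := by gcongr
          refine le_of_mul_le_mul_left ?_ hτ
          linarith
      · rintro I ⟨hI', hA⟩ v hv
        have hvX := (hI I hI').1 hv
        refine mem_filter.2 ⟨hvX, ?_⟩
        by_contra h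
        exact hA v (mem_filter.2 ⟨hvX, h⟩) hv
    · intro v hv
      obtain ⟨hvX, hvc⟩ := mem_filter.1 hv
      push Not at hvc
      set u' : Finset α → ℝ := fun e => u e + if v ∈ e then 0 else w (insert v e) with hu'
      have hu'deg : ∀ T, wdeg X i u' T =
          wdeg X i u T + if v ∈ T then 0 else wdeg X (i + 1) w (insert v T) := fun T =>
        wdeg_add_link hvX
      have huu' : ∀ e, u e ≤ u' e := fun e => by
        simp only [hu']
        split_ifs
        exacts [by simp, le_add_of_nonneg_right (hw _)]
      have hss : saturated X i K τ u ⊆ saturated X i K τ u' := by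
        intro T hT
        rw [saturated, mem_filter] at hT ⊢
        exact ⟨hT.1, hT.2.1, hT.2.2.trans_le (wdeg_mono huu')⟩
      classical
      set w' : Finset α → ℝ := fun e =>
        if v ∈ e ∨ ∃ T ∈ saturated X i K τ u', T ⊆ e then 0 else w e with hw'
      have hw'w : ∀ e, w' e ≤ w e := fun e => by
        simp only [hw']
        split_ifs
        exacts [hw e, le_rfl]
      have hempty : wdeg X i u' ∅ = wdeg X i u ∅ + wdeg X (i + 1) w {v} := by
        simpa using hu'deg ∅
      refine iht w' u' _ (fun e => ?_) (fun e => (hu e).trans (huu' e)) ?_ ?_ ?_ ?_ ?_ ?_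
      · simp only [hw']
        split_ifs
        exacts [le_rfl, hw e]
      · push_cast at htot
        rw [hempty]
        linarith
      · exact fun T hT => (mul_le_mul_of_nonneg_left (wdeg_mono hw'w) hτ.le).trans (hwdeg T hT)
      · intro T hT
        rw [hu'deg]
        by_cases hTs : T ∈ saturated X i K τ u
        · have : wdeg X (i + 1) w (insert v T) = 0 :=
            wdeg_eq_zero fun e _ he => hsat T hTs e ((subset_insert _ _).trans he)
          rw [this, ite_self, add_zero]
          exact hudeg T hT
        · have h1 := wdeg_le_of_notMem_saturated hK.le hτ.le hT hTs
          have h2 : (if v ∈ T then 0 else wdeg X (i + 1) w (insert v T)) ≤ K * τ ^ T.card := by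
            split_ifs with hvT
            · positivity
            · have := hwdeg (insert v T) (insert_nonempty _ _)
              rw [card_insert_of_notMem hvT, pow_succ] at this
              refine le_of_mul_le_mul_left ?_ hτ
              linarith
          linarith
      · intro T hT e hTe
        exact if_pos (Or.inr ⟨T, hT, hTe⟩)
      · have h1 : wdeg X (i + 1) w ∅ ≤ wdeg X (i + 1) w' ∅ + wdeg X (i + 1) w {v} +
            ∑ T ∈ saturated X i K τ u', wdeg X (i + 1) w T := wdeg_empty_le_delete hw v _
        have h2 : τ * ∑ T ∈ saturated X i K τ u', wdeg X (i + 1) w T ≤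
            ∑ T ∈ saturated X i K τ u' \ saturated X i K τ u, K * τ ^ T.card := by
          rw [← sum_sdiff hss, sum_eq_zero (s := saturated X i K τ u) fun T hT =>
            wdeg_eq_zero fun e _ he => hsat T hT e he, add_zero, mul_sum]
          exact sum_le_sum fun T hT => hwdeg T (mem_filter.1 (mem_sdiff.1 hT).1).2.1
        have h3 := sum_sdiff (f := fun T : Finset α => K * τ ^ T.card) hss
        have h4 := mul_le_mul_of_nonneg_left h1 hτ.le
        rw [hempty]
        linarith
      · rintro I ⟨hI', hvI⟩
        obtain ⟨hIX, hIw, hIu⟩ := hI I hI'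
        refine ⟨hIX, fun e he heI => ?_, fun e he heI => ?_⟩
        · simp [hw', hIw e he heI]
        · simp only [hu', hIu e he heI, zero_add]
          split_ifs with hve
          · rfl
          · rw [mem_powersetCard] at he
            exact hIw _ (mem_powersetCard.2 ⟨insert_subset hvX he.1,
              by rw [card_insert_of_notMem hve, he.2]⟩) (insert_subset hvI heI)

theorem exists_hasContainers_step (i : ℕ) : ∀ K : ℝ, 0 < K → ∃ κ : ℝ, 0 < κ ∧
    ∀ (N τ : ℝ) (m : ℕ) (X : Finset α) (w : Finset α → ℝ) (𝓘 : Set (Finset α)),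
      0 < N → 0 < τ → τ ≤ 1 → (m : ℝ) = τ * N → (X.card : ℝ) ≤ N → (∀ e, 0 ≤ w e) →
      N ≤ wdeg X i w ∅ →
      (∀ T : Finset α, T.Nonempty → τ * wdeg X i w T ≤ K * τ ^ T.card) →
      (∀ I ∈ 𝓘, I ⊆ X ∧ ∀ e ∈ X.powersetCard i, e ⊆ I → w e = 0) →
      HasContainers 𝓘 (i * m) fun Y => Y ⊆ X ∧ (Y.card : ℝ) + κ * N ≤ X.card := by
  induction i with
  | zero =>
    intro K _
    refine ⟨1, one_pos, fun N τ m X w 𝓘 hN _ _ _ _ _ htot _ hI =>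
      HasContainers.of_isEmpty fun I h => ?_⟩
    have := (hI I h).2 ∅ (by simp) (empty_subset _)
    simp [wdeg, this] at htot
    linarith
  | succ i ih =>
    intro K hK
    set c : ℝ := 1 / (4 * 2 ^ i) with hc
    have hc0 : 0 < c := by positivity
    obtain ⟨κ, hκ, ih⟩ := ih (2 * K / c) (by positivity)
    refine ⟨min κ (1 / (4 * K)), by positivity,
      fun N τ m X w 𝓘 hN hτ hτ1 hm hX hw htot hdeg hI => ?_⟩
    have hs : saturated X i K τ (fun _ => 0) = ∅ := by
      refine filter_eq_empty_iff.2 fun T _ h => h.2.not_ge ?_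
      simp only [wdeg, ite_self, sum_const_zero]
      positivity
    rw [show (i + 1) * m = m + i * m by ring]
    refine hasContainers_of_fuel hN hτ hτ1 hm hX hK
      (show c * (4 * 2 ^ i) = 1 by rw [hc]; field_simp) (fun Y hY hYc => ⟨hY, hYc.trans' ?_⟩)
      (fun u 𝓙 hu hutot hudeg hJ =>
        (ih N τ m X u 𝓙 hN hτ hτ1 hm hX hu hutot hudeg hJ).imp fun Y hY =>
          ⟨hY.1, hY.2.trans' ?_⟩)
      m w (fun _ => 0) 𝓘 hw (fun _ => le_rfl) ?_ hdeg ?_ ?_ ?_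
      fun I h => ⟨(hI I h).1, (hI I h).2, fun _ _ _ => rfl⟩
    rotate_left 4
    · gcongr
      exact min_le_right _ _
    · gcongr
      exact min_le_left _ _
    · simp [wdeg]
    · intro T _
      simp only [wdeg, ite_self, sum_const_zero]
      positivity
    · simp [hs]
    · rw [hs]
      simp only [wdeg, ite_self, sum_const_zero, mul_zero, add_zero, sum_empty]
      exact mul_le_mul_of_nonneg_left (by simpa [wdeg] using htot) hτ.le

/-- The hypergraph container theorem for a weighted `(k + 1)`-uniform hypergraph. -/
theorem exists_hasContainers (k : ℕ) (K ε : ℝ) (hK : 0 < K) (hε : 0 < ε) : ∃ j : ℕ,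
    ∀ (N τ : ℝ) (m : ℕ) (V : Finset α) (w : Finset α → ℝ) (𝓘 : Set (Finset α)),
      0 < N → 0 < τ → τ ≤ 1 → (m : ℝ) = τ * N → (V.card : ℝ) ≤ N → (∀ e, 0 ≤ w e) →
      (∀ T : Finset α, T.Nonempty → τ * wdeg V (k + 1) w T ≤ K * τ ^ T.card) →
      (∀ I ∈ 𝓘, I ⊆ V ∧ ∀ e ∈ V.powersetCard (k + 1), e ⊆ I → w e = 0) →
      HasContainers 𝓘 (j * ((k + 1) * m)) fun Y => Y ⊆ V ∧ wdeg Y (k + 1) w ∅ < ε * N := by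
  obtain ⟨κ, hκ, step⟩ := exists_hasContainers_step (α := α) (k + 1) (K / ε) (by positivity)
  refine ⟨⌈1 / κ⌉₊, fun N τ m V w 𝓘 hN hτ hτ1 hm hV hw hdeg hI => ?_⟩
  have rounds : ∀ (j : ℕ) (X : Finset α) (𝓙 : Set (Finset α)), X ⊆ V → (X.card : ℝ) ≤ j * (κ * N) →
      (∀ I ∈ 𝓙, I ⊆ X ∧ ∀ e ∈ V.powersetCard (k + 1), e ⊆ I → w e = 0) →
      HasContainers 𝓙 (j * ((k + 1) * m)) fun Y => Y ⊆ V ∧ wdeg Y (k + 1) w ∅ < ε * N := by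
    intro j
    induction j with
    | zero =>
      intro X 𝓙 hXV hX hJ
      obtain rfl : X = ∅ := by simpa using hX
      refine HasContainers.of_subset (X := ∅) ⟨hXV, ?_⟩ fun I h => (hJ I h).1
      rw [wdeg, powersetCard_eq_empty.2 (by simp), sum_empty]
      positivity
    | succ j ihj =>
      intro X 𝓙 hXV hX hJ
      by_cases hsmall : wdeg X (k + 1) w ∅ < ε * N
      · exact HasContainers.of_subset (X := X) ⟨hXV, hsmall⟩ fun I h => (hJ I h).1
      push Not at hsmall
      rw [show (j + 1) * ((k + 1) * m) = (k + 1) * m + j * ((k + 1) * m) by ring]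
      refine (step N τ m X (fun e => w e / ε) 𝓙 hN hτ hτ1 hm ?_
        (fun e => div_nonneg (hw e) hε.le) ?_ ?_ fun I h => ⟨(hJ I h).1, fun e he heI => ?_⟩).comp
        fun Y hY => ihj Y _ (hY.1.trans hXV) ?_ fun I h => ⟨h.2, (hJ I h.1).2⟩
      · exact le_trans (by exact_mod_cast card_le_card hXV) hV
      · rw [wdeg_div, le_div_iff₀ hε]
        linarith
      · intro T hT
        rw [wdeg_div, ← mul_div_assoc, div_mul_eq_mul_div]
        refine div_le_div_of_nonneg_right (le_trans ?_ (hdeg T hT)) hε.le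
        exact mul_le_mul_of_nonneg_left (wdeg_subset hw hXV) hτ.le
      · simp [(hJ I h).2 e (powersetCard_mono hXV he) heI]
      · have := hY.2
        push_cast at hX
        linarith
  refine rounds _ V 𝓘 subset_rfl (hV.trans ?_) hI
  calc N = 1 / κ * (κ * N) := by field_simp
    _ ≤ _ := by gcongr; exact Nat.le_ceil _

end ContainerStep

theorem wdeg_card_fiber {α β : Type*} [DecidableEq α] {X : Finset α} {k : ℕ} (T : Finset α)
    (Φ : Finset β) (g : β → Finset α) (hg : ∀ φ ∈ Φ, (g φ).card = k) :
    wdeg X k (fun E => ((Φ.filter fun φ => g φ = E).card : ℝ)) T =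
      ((Φ.filter fun φ => T ⊆ g φ ∧ g φ ⊆ X).card : ℝ) := by
  rw [wdeg, ← sum_filter, card_eq_sum_card_fiberwise (f := g)
    (t := (X.powersetCard k).filter (T ⊆ ·)), Nat.cast_sum]
  · refine sum_congr rfl fun E hE => ?_
    rw [mem_filter, mem_powersetCard] at hE
    congr 2
    ext φ
    simp only [mem_filter]
    constructor
    · rintro ⟨h, rfl⟩
      exact ⟨⟨h, hE.2, hE.1.1⟩, rfl⟩
    · exact fun h => ⟨h.1.1, h.2⟩
  · intro φ hφ
    simp only [coe_filter, Set.mem_ofPred_eq, mem_powersetCard] at hφ ⊢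
    exact ⟨⟨hφ.2.2, hg φ hφ.1⟩, hφ.2.1⟩

section Embeddings

open Classical in
theorem piecewise_subset_image_pi (V : Finset ℕ) (B : ℕ → Finset ℕ) :
    {φ : ℕ → ℕ | (∀ v, v ∉ V → φ v = 0) ∧ ∀ v ∈ V, φ v ∈ B v} ⊆
      ↑((V.pi B).image fun f v => if h : v ∈ V then f v h else 0) := by
  rintro φ ⟨h0, hB⟩
  rw [mem_coe, mem_image]
  refine ⟨fun v _ => φ v, mem_pi.2 hB, ?_⟩
  funext v
  split_ifs with h
  exacts [rfl, (h0 v h).symm]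

theorem card_le_prod_of_forall_mem {V : Finset ℕ} {B : ℕ → Finset ℕ} {Φ : Finset (ℕ → ℕ)}
    (h0 : ∀ φ ∈ Φ, ∀ v, v ∉ V → φ v = 0) (hB : ∀ φ ∈ Φ, ∀ v ∈ V, φ v ∈ B v) :
    Φ.card ≤ ∏ v ∈ V, (B v).card := by
  classical
  rw [← card_pi]
  refine le_trans (card_le_card fun φ hφ => ?_)
    (card_image_le (f := fun f v => if h : v ∈ V then f v h else 0))
  exact mem_coe.1 (piecewise_subset_image_pi V B ⟨h0 φ hφ, hB φ hφ⟩)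

variable {r : ℕ}

theorem finite_embeddings (F : HGraph r) (n : ℕ) :
    {φ : ℕ → ℕ | (∀ v, v ∉ F.verts → φ v = 0) ∧ Set.InjOn φ ↑F.verts ∧
      ∀ v ∈ F.verts, φ v ∈ range n}.Finite :=
  (finite_toSet _).subset fun _ hφ =>
    piecewise_subset_image_pi F.verts (fun _ => range n) ⟨hφ.1, hφ.2.2⟩

/-- The injections from the vertices of `F` to `{0, …, n-1}`, extended by zero. -/
noncomputable def embeddings (F : HGraph r) (n : ℕ) : Finset (ℕ → ℕ) :=
  (finite_embeddings F n).toFinset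

/-- The edges of the copy of `F` given by `φ`. -/
def imageEdges (F : HGraph r) (φ : ℕ → ℕ) : Finset (Finset ℕ) :=
  F.edges.image fun e => e.image φ

theorem mem_embeddings {F : HGraph r} {n : ℕ} {φ : ℕ → ℕ} :
    φ ∈ embeddings F n ↔ (∀ v, v ∉ F.verts → φ v = 0) ∧ Set.InjOn φ ↑F.verts ∧
      ∀ v ∈ F.verts, φ v ∈ range n := by
  simp [embeddings]

theorem injOn_image_of_injOn {F : HGraph r} {φ : ℕ → ℕ} (hφ : Set.InjOn φ ↑F.verts) :
    Set.InjOn (fun e : Finset ℕ => e.image φ) ↑F.edges := by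
  intro e he e' he' h
  rw [← coe_inj] at h ⊢
  simp only [coe_image] at h
  exact (hφ.image_eq_image_iff (coe_subset.2 (F.edge_sub e he))
    (coe_subset.2 (F.edge_sub e' he'))).1 h

theorem card_imageEdges {F : HGraph r} {n : ℕ} {φ : ℕ → ℕ} (hφ : φ ∈ embeddings F n) :
    (imageEdges F φ).card = F.edges.card :=
  card_image_of_injOn (injOn_image_of_injOn (mem_embeddings.1 hφ).2.1)

theorem copyCount_eq (F G : HGraph r) (n : ℕ) (hG : G.verts = range n) :
    copyCount F G = ((embeddings F n).filter fun φ => ∅ ⊆ imageEdges F φ ∧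
      imageEdges F φ ⊆ G.edges).card := by
  rw [copyCount, copyCountWith, ← Set.ncard_coe_finset]
  congr 1
  ext φ
  simp only [Set.mem_ofPred_eq, coe_filter, mem_embeddings, hG, imageEdges, image_subset_iff,
    empty_subset, true_and, and_true, and_assoc]

theorem card_embeddings_image_eq (F : HGraph r) (n : ℕ) {A : Finset (Finset ℕ)}
    (hA : A ⊆ F.edges) (T : Finset (Finset ℕ)) :
    ((embeddings F n).filter fun φ => A.image (fun e => e.image φ) = T).card ≤
      F.verts.card ^ F.verts.card * n ^ (F.verts.card - (A.biUnion id).card) := by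
  set U := A.biUnion id with hU
  have hUV : U ⊆ F.verts := biUnion_subset.2 fun e he => F.edge_sub e (hA he)
  have himage : ∀ φ : ℕ → ℕ, A.image (fun e => e.image φ) = T → U.image φ = T.biUnion id := by
    rintro φ rfl
    ext x
    simp only [hU, mem_image, mem_biUnion, id]
    constructor
    · rintro ⟨y, ⟨e, he, hy⟩, rfl⟩
      exact ⟨_, ⟨e, he, rfl⟩, mem_image_of_mem _ hy⟩
    · rintro ⟨_, ⟨e, he, rfl⟩, hx⟩
      obtain ⟨y, hy, rfl⟩ := mem_image.1 hx
      exact ⟨y, ⟨e, he, hy⟩, rfl⟩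
  rcases eq_empty_or_nonempty ((embeddings F n).filter
    fun φ => A.image (fun e => e.image φ) = T) with h | ⟨φ₀, hφ₀⟩
  · rw [h]
    simp
  have hW : (T.biUnion id).card ≤ U.card := by
    rw [← himage φ₀ (mem_filter.1 hφ₀).2]
    exact card_image_le
  calc _ ≤ ∏ v ∈ F.verts, (if v ∈ U then T.biUnion id else range n).card := by
        refine card_le_prod_of_forall_mem (fun φ hφ => ?_) fun φ hφ v hv => ?_
        · exact (mem_embeddings.1 (mem_filter.1 hφ).1).1
        · rw [mem_filter, mem_embeddings] at hφ
          split_ifs with h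
          · rw [← himage φ hφ.2]
            exact mem_image_of_mem _ h
          · exact hφ.1.2.2 v hv
    _ = (T.biUnion id).card ^ U.card * n ^ (F.verts.card - U.card) := by
        simp only [apply_ite Finset.card, card_range]
        rw [prod_ite, prod_const, prod_const, filter_mem_eq_inter, inter_eq_right.2 hUV,
          filter_notMem_eq_sdiff, card_sdiff_of_subset hUV]
    _ ≤ _ := by
        refine Nat.mul_le_mul_right _ ?_
        rcases Nat.eq_zero_or_pos U.card with h | h
        · rw [h, pow_zero]
          exact Nat.one_le_iff_ne_zero.2 (by
            rcases Nat.eq_zero_or_pos F.verts.card with h' | h'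
            · simp [h']
            · positivity)
        · exact (Nat.pow_le_pow_left (hW.trans (card_le_card hUV)) _).trans
            (Nat.pow_le_pow_right (h.trans_le (card_le_card hUV)) (card_le_card hUV))

end Embeddings

section Density

variable {r : ℕ} {F : HGraph r}

theorem le_mDensity (hF : 2 ≤ F.edges.card) {J : HGraph r} (hJ : HGSub J F)
    (hr : r < J.verts.card) :
    ((J.edges.card : ℝ) - 1) / ((J.verts.card : ℝ) - r) ≤ mDensity r F := by
  rw [mDensity, if_neg (by omega), if_neg (by omega)]
  refine le_csSup ⟨F.edges.card, ?_⟩ ⟨J, hJ, hr, rfl⟩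
  rintro x ⟨J, hJ, hr, rfl⟩
  have h1 : (1 : ℝ) ≤ (J.verts.card : ℝ) - r := by
    have : ((r + 1 : ℕ) : ℝ) ≤ J.verts.card := by exact_mod_cast hr
    push_cast at this
    linarith
  have h2 : (J.edges.card : ℝ) ≤ F.edges.card := by exact_mod_cast card_le_card hJ.2
  rw [div_le_iff₀ (by linarith)]
  nlinarith [Nat.cast_nonneg (α := ℝ) F.edges.card]

theorem card_sub_one_le_mDensity_mul (hF : 2 ≤ F.edges.card) {A : Finset (Finset ℕ)}
    (hA : A ⊆ F.edges) (hne : A.Nonempty) :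
    (A.card : ℝ) - 1 ≤ mDensity r F * (((A.biUnion id).card : ℝ) - r) := by
  obtain ⟨a, ha⟩ := hne
  have hle : r ≤ (A.biUnion id).card :=
    (F.edge_card a (hA ha)).symm.trans_le (card_le_card (subset_biUnion_of_mem id ha))
  rcases hle.eq_or_lt with h | h
  · have : A ⊆ {A.biUnion id} := fun e he => mem_singleton.2
      (eq_of_subset_of_card_le (subset_biUnion_of_mem id he)
        (by rw [F.edge_card e (hA he), ← h]))
    have h1 : (A.card : ℝ) ≤ 1 := by exact_mod_cast card_le_card this
    rw [← h, sub_self, mul_zero]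
    linarith
  · have h1 : (0 : ℝ) < ((A.biUnion id).card : ℝ) - r := sub_pos.2 (by exact_mod_cast h)
    rw [← div_le_iff₀ h1]
    exact le_mDensity hF (J := ⟨A.biUnion id, A, fun e he => subset_biUnion_of_mem id he,
      fun e he => F.edge_card e (hA he)⟩)
      ⟨biUnion_subset.2 fun e he => F.edge_sub e (hA he), hA⟩ h

theorem one_div_le_mDensity (hr : 0 < r) (hF : 2 ≤ F.edges.card) : 1 / (r : ℝ) ≤ mDensity r F := by
  obtain ⟨a, ha, b, hb, hab⟩ := one_lt_card.1 hF
  have hA : ({a, b} : Finset (Finset ℕ)) ⊆ F.edges := by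
    simp [insert_subset_iff, ha, hb]
  have h := card_sub_one_le_mDensity_mul hF hA (insert_nonempty _ _)
  rw [card_pair hab, biUnion_insert, singleton_biUnion, id, id] at h
  have hra := F.edge_card a ha
  have hrb := F.edge_card b hb
  have h1 : ((a ∪ b).card : ℝ) ≤ r + r := by
    exact_mod_cast (card_union_le a b).trans_eq (by rw [hra, hrb])
  have h2 : (r : ℝ) ≤ (a ∪ b).card := by
    exact_mod_cast hra ▸ card_le_card (subset_union_left (s₁ := a) (s₂ := b))
  have hr' : (0 : ℝ) < r := by exact_mod_cast hr
  rw [div_le_iff₀ hr']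
  push_cast at h
  by_contra! hm
  rcases le_or_gt 0 (mDensity r F) with h0 | h0 <;> nlinarith

theorem pow_card_sub_le (hr : 0 < r) (hF : 2 ≤ F.edges.card) {A : Finset (Finset ℕ)}
    (hA : A ⊆ F.edges) (hne : A.Nonempty) {n : ℕ} (hn : 1 ≤ n) {τ : ℝ}
    (hτ : (n : ℝ) ^ (-(1 / mDensity r F)) ≤ τ) :
    τ * (n : ℝ) ^ (F.verts.card - (A.biUnion id).card) ≤
      τ ^ A.card * (n : ℝ) ^ (F.verts.card - r) := by
  have hn0 : (0 : ℝ) < n := by exact_mod_cast hn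
  have hn1 : (1 : ℝ) ≤ n := by exact_mod_cast hn
  have hm : 0 < mDensity r F := lt_of_lt_of_le (by positivity) (one_div_le_mDensity hr hF)
  have hτ0 : 0 < τ := (Real.rpow_pos_of_pos hn0 _).trans_le hτ
  have hUV : (A.biUnion id).card ≤ F.verts.card :=
    card_le_card (biUnion_subset.2 fun e he => F.edge_sub e (hA he))
  obtain ⟨a, ha⟩ := id hne
  have hle : r ≤ (A.biUnion id).card :=
    (F.edge_card a (hA ha)).symm.trans_le (card_le_card (subset_biUnion_of_mem id ha))
  obtain ⟨j, hj⟩ : ∃ j, A.card = j + 1 := ⟨A.card - 1, by have := card_pos.2 hne; omega⟩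
  have hd := card_sub_one_le_mDensity_mul hF hA hne
  rw [hj] at hd ⊢
  push_cast at hd
  rw [pow_succ', mul_assoc]
  refine mul_le_mul_of_nonneg_left ?_ hτ0.le
  calc (n : ℝ) ^ (F.verts.card - (A.biUnion id).card)
      = (n : ℝ) ^ ((F.verts.card : ℝ) - (A.biUnion id).card) := by
        rw [← Nat.cast_sub hUV, Real.rpow_natCast]
    _ ≤ (n : ℝ) ^ (-(1 / mDensity r F) * j + ((F.verts.card : ℝ) - r)) := by
        refine Real.rpow_le_rpow_of_exponent_le hn1 ?_
        have : (j : ℝ) / mDensity r F ≤ ((A.biUnion id).card : ℝ) - r := by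
          rw [div_le_iff₀ hm]
          linarith
        rw [neg_mul, one_div_mul_eq_div]
        linarith
    _ = ((n : ℝ) ^ (-(1 / mDensity r F))) ^ j * (n : ℝ) ^ (F.verts.card - r) := by
        rw [Real.rpow_add hn0, Real.rpow_mul hn0.le, Real.rpow_natCast,
          ← Nat.cast_sub (hle.trans hUV), Real.rpow_natCast]
    _ ≤ _ := by gcongr

theorem card_embeddings_subset_imageEdges (hr : 0 < r) (hF : 2 ≤ F.edges.card) {n : ℕ}
    (hn : 1 ≤ n) {τ : ℝ} (hτ : (n : ℝ) ^ (-(1 / mDensity r F)) ≤ τ) {T : Finset (Finset ℕ)}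
    (hT : T.Nonempty) :
    τ * (((embeddings F n).filter fun φ => T ⊆ imageEdges F φ).card : ℝ) ≤
      2 ^ F.edges.card * (F.verts.card : ℝ) ^ F.verts.card * τ ^ T.card *
        (n : ℝ) ^ (F.verts.card - r) := by
  classical
  have hτ0 : 0 < τ := (Real.rpow_pos_of_pos (by exact_mod_cast hn) _).trans_le hτ
  set P : Finset (Finset (Finset ℕ)) := F.edges.powerset.filter fun A => A.card = T.card with hP
  have hsub : ((embeddings F n).filter fun φ => T ⊆ imageEdges F φ) ⊆
      P.biUnion fun A => (embeddings F n).filter fun φ => A.image (fun e => e.image φ) = T := by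
    intro φ h
    obtain ⟨hφ, hTφ⟩ := mem_filter.1 h
    obtain ⟨A, hA, rfl⟩ := subset_image_iff.1 hTφ
    refine mem_biUnion.2 ⟨A, mem_filter.2 ⟨mem_powerset.2 hA, ?_⟩, mem_filter.2 ⟨hφ, rfl⟩⟩
    exact (card_image_of_injOn
      ((injOn_image_of_injOn (mem_embeddings.1 hφ).2.1).mono (coe_subset.2 hA))).symm
  have hterm : ∀ A ∈ P, τ * (((embeddings F n).filter
      fun φ => A.image (fun e => e.image φ) = T).card : ℝ) ≤
      (F.verts.card : ℝ) ^ F.verts.card * τ ^ T.card * (n : ℝ) ^ (F.verts.card - r) := by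
    intro A hAP
    obtain ⟨hA, hAT⟩ := mem_filter.1 hAP
    rw [mem_powerset] at hA
    have h1 := pow_card_sub_le hr hF hA (card_pos.1 (hAT ▸ card_pos.2 hT)) hn hτ
    have h2 : (((embeddings F n).filter fun φ => A.image (fun e => e.image φ) = T).card : ℝ) ≤
        (F.verts.card : ℝ) ^ F.verts.card * (n : ℝ) ^ (F.verts.card - (A.biUnion id).card) := by
      exact_mod_cast card_embeddings_image_eq F n hA T
    rw [hAT] at h1
    calc _ ≤ τ * ((F.verts.card : ℝ) ^ F.verts.card *
          (n : ℝ) ^ (F.verts.card - (A.biUnion id).card)) := by gcongr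
      _ = (F.verts.card : ℝ) ^ F.verts.card *
          (τ * (n : ℝ) ^ (F.verts.card - (A.biUnion id).card)) := by ring
      _ ≤ _ := by rw [mul_assoc]; gcongr
  have hPcard : (P.card : ℝ) ≤ 2 ^ F.edges.card := by
    have := (card_filter_le F.edges.powerset fun A => A.card = T.card).trans_eq (card_powerset _)
    exact_mod_cast this
  calc τ * (((embeddings F n).filter fun φ => T ⊆ imageEdges F φ).card : ℝ)
      ≤ τ * ∑ A ∈ P, (((embeddings F n).filter
          fun φ => A.image (fun e => e.image φ) = T).card : ℝ) := by
        gcongr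
        exact_mod_cast (card_le_card hsub).trans card_biUnion_le
    _ ≤ P.card * ((F.verts.card : ℝ) ^ F.verts.card * τ ^ T.card *
          (n : ℝ) ^ (F.verts.card - r)) := by
        rw [mul_sum, ← nsmul_eq_mul]
        exact sum_le_card_nsmul _ _ _ hterm
    _ ≤ 2 ^ F.edges.card * ((F.verts.card : ℝ) ^ F.verts.card * τ ^ T.card *
          (n : ℝ) ^ (F.verts.card - r)) := by gcongr
    _ = _ := by ring

end Density

/-- The `r`-graph on `{0, …, n-1}` whose edges are the `r`-subsets of `{0, …, n-1}` in `E`. -/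
def HGraph.ofEdges (r n : ℕ) (E : Finset (Finset ℕ)) : HGraph r where
  verts := range n
  edges := E ∩ (range n).powersetCard r
  edge_sub := fun _ he => (mem_powersetCard.1 (mem_inter.1 he).2).1
  edge_card := fun _ he => (mem_powersetCard.1 (mem_inter.1 he).2).2

/-- hypergraph container lemma. -/
theorem containers (r : ℕ) (hr : 2 ≤ r) (F : HGraph r) (hF : 2 ≤ F.edges.card)
    (δ : ℝ) (hδ : 0 < δ) :
    ∃ α : ℝ, 0 < α ∧
      ∀ n : ℕ, α ≤ (n : ℝ) →
        ∃ (S : Set (HGraph r)) (C : HGraph r → HGraph r),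
          (∀ s ∈ S, s.verts = Finset.range n) ∧
          (∀ s ∈ S, (C s).verts = Finset.range n) ∧
          (∀ s ∈ S, (s.edges.card : ℝ) ≤ α * (n : ℝ) ^ ((r : ℝ) - 1 / mDensity r F)) ∧
          (∀ s ∈ S, (copyCount F (C s) : ℝ) < δ * (n : ℝ) ^ F.verts.card) ∧
          (∀ G : HGraph r, G.verts = Finset.range n → ¬ HasCopy F G →
            ∃ s ∈ S, s.edges ⊆ G.edges ∧ G.edges ⊆ (C s).edges) := by
  obtain ⟨k, hk⟩ : ∃ k, F.edges.card = k + 1 := ⟨F.edges.card - 1, by omega⟩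
  have hr0 : 0 < r := by omega
  have hrv : r ≤ F.verts.card := by
    obtain ⟨e, he⟩ : F.edges.Nonempty := card_pos.1 (by omega)
    exact (F.edge_card e he).symm.trans_le (card_le_card (F.edge_sub e he))
  have hv : 0 < F.verts.card := by omega
  set K : ℝ := 2 ^ F.edges.card * (F.verts.card : ℝ) ^ F.verts.card
  have hm := one_div_le_mDensity hr0 hF
  have hr' : (0 : ℝ) < r := by exact_mod_cast hr0
  have hm0 : 0 < mDensity r F := lt_of_lt_of_le (by positivity) hm
  obtain ⟨j, hj⟩ := exists_hasContainers (α := Finset ℕ) k K δ (by positivity) hδ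
  refine ⟨max 1 (j * (k + 1) * 2), by positivity, fun n hn => ?_⟩
  have hn1 : (1 : ℝ) ≤ n := (le_max_left _ _).trans hn
  have hn0 : (0 : ℝ) < n := by linarith
  set τ₀ : ℝ := (n : ℝ) ^ (-(1 / mDensity r F)) with hτ₀
  have hτ₀0 : 0 < τ₀ := Real.rpow_pos_of_pos hn0 _
  have hτ₀1 : τ₀ ≤ 1 := Real.rpow_le_one_of_one_le_of_nonpos hn1 (by simpa using hm0.le)
  set N : ℝ := (n : ℝ) ^ r with hN
  have hN0 : 0 < N := by positivity
  have hτN : τ₀ * N = (n : ℝ) ^ ((r : ℝ) - 1 / mDensity r F) := by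
    rw [hτ₀, hN, ← Real.rpow_natCast, ← Real.rpow_add hn0]
    ring_nf
  have hτN1 : 1 ≤ τ₀ * N := by
    rw [hτN]
    refine Real.one_le_rpow hn1 (sub_nonneg.2 ?_)
    rwa [div_le_comm₀ hr' hm0] at hm
  set m : ℕ := ⌈τ₀ * N⌉₊
  have hm2 : (m : ℝ) ≤ 2 * (τ₀ * N) := by
    have := Nat.ceil_lt_add_one (zero_le_one.trans hτN1)
    linarith
  have hmN : (m : ℝ) ≤ N := by
    have : m ≤ n ^ r := Nat.ceil_le.2 (by
      push_cast
      calc τ₀ * N ≤ 1 * N := by gcongr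
        _ = _ := one_mul _)
    rw [hN]
    exact_mod_cast this
  have hτ : τ₀ ≤ m / N := (le_div_iff₀ hN0).2 (Nat.le_ceil _)
  set V := (range n).powersetCard r with hV
  have hpos : (0 : ℝ) < (n : ℝ) ^ (F.verts.card - r) := by positivity
  set w : Finset (Finset ℕ) → ℝ := fun E =>
    (((embeddings F n).filter fun φ => imageEdges F φ = E).card : ℝ) /
      (n : ℝ) ^ (F.verts.card - r) with hw
  have hwdeg : ∀ X T, wdeg X (k + 1) w T =
      (((embeddings F n).filter fun φ => T ⊆ imageEdges F φ ∧ imageEdges F φ ⊆ X).card : ℝ) /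
        (n : ℝ) ^ (F.verts.card - r) := by
    intro X T
    rw [hw, wdeg_div, wdeg_card_fiber T _ _ fun φ hφ => (card_imageEdges hφ).trans hk]
  have hcont := hj N (m / N) m V w
    {I | ∃ G : HGraph r, G.verts = range n ∧ ¬ HasCopy F G ∧ G.edges = I} hN0
    (hτ₀0.trans_le hτ) ((div_le_one hN0).2 hmN) (by field_simp) ?_ (fun E => by positivity) ?_ ?_
  · obtain ⟨𝒮, f, h𝒮, hf⟩ := hcont.exists_fun
    refine ⟨{s | s.verts = range n ∧ s.edges ∈ 𝒮}, fun s => HGraph.ofEdges r n (f s.edges),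
      fun s hs => hs.1, fun s _ => rfl, fun s hs => ?_, fun s hs => ?_, fun G hG hGF => ?_⟩
    · have h1 : (s.edges.card : ℝ) ≤ j * ((k + 1) * m) := by
        exact_mod_cast (h𝒮 _ hs.2).1
      rw [← hτN]
      calc (s.edges.card : ℝ) ≤ j * ((k + 1) * (2 * (τ₀ * N))) := h1.trans (by gcongr)
        _ = j * (k + 1) * 2 * (τ₀ * N) := by ring
        _ ≤ _ := by gcongr; exact le_max_right _ _
    · have h1 := (h𝒮 _ hs.2).2.2
      have h2 : (HGraph.ofEdges r n (f s.edges)).edges = f s.edges :=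
        inter_eq_left.2 (h𝒮 _ hs.2).2.1
      rw [hwdeg, div_lt_iff₀ hpos, mul_assoc, hN, ← pow_add, Nat.add_sub_cancel' hrv] at h1
      rwa [copyCount_eq F _ n rfl, h2]
    · obtain ⟨S, hS, hSG, hGS⟩ := hf G.edges ⟨G, hG, hGF, rfl⟩
      refine ⟨⟨range n, S, fun e he => hG ▸ G.edge_sub e (hSG he),
        fun e he => G.edge_card e (hSG he)⟩, ⟨rfl, hS⟩, hSG, fun e he => ?_⟩
      exact mem_inter.2 ⟨hGS he, mem_powersetCard.2 ⟨hG ▸ G.edge_sub e he, G.edge_card e he⟩⟩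
  · have := Nat.choose_le_pow n r
    rw [hV, card_powersetCard, card_range, hN]
    exact_mod_cast this
  · intro T hT
    rw [hwdeg, ← mul_div_assoc, div_le_iff₀ hpos]
    refine le_trans ?_ (card_embeddings_subset_imageEdges hr0 hF (by exact_mod_cast hn1) hτ hT)
    gcongr
    exact fun h => h.1
  · rintro I ⟨G, hG, hGF, rfl⟩
    refine ⟨fun e he => mem_powersetCard.2 ⟨hG ▸ G.edge_sub e he, G.edge_card e he⟩,
      fun E _ hEG => ?_⟩
    rw [hw]
    refine div_eq_zero_iff.2 (Or.inl ?_)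
    rw [Nat.cast_eq_zero, card_eq_zero, filter_eq_empty_iff]
    rintro φ hφ rfl
    obtain ⟨-, hinj, hmem⟩ := mem_embeddings.1 hφ
    exact hGF ⟨φ, hinj, fun v hv => hG ▸ hmem v hv, fun e he =>
      ⟨hEG (mem_image_of_mem _ he), trivial⟩⟩
end

section
/- Let s > r ≥ 2 be integers, let F be an r-graph with e(F) ≥ 2, and let δ > 0 be such that every red-blue coloring of the edges of K^{(r)}_n contains at least δ·n^s red copies of K^{(r)}_s or at least δ·n^{v(F)} blue copies of F. Let 𝒮 be a collection of r-graphs on [n] and 𝒞 = {C(S) : S ∈ 𝒮} a collection of r-graphs on [n] such that every C ∈ 𝒞 contains fewer than δ·n^{v(F)} copies of F, and every F-free r-graph G on [n] satisfies S ⊆ G ⊆ C(S) for some S ∈ 𝒮. Let H be any s-graph on [n]. Then for every subhypergraph H_0 ⊆ H with e(H_0) ≥ (1−δ)·e(H), if G[H_0,r] ↛ (K^{(r)}_s, F), then there exist S ∈ 𝒮 and C = C(S) ∈ 𝒞 with S ⊆ C such that S ⊑ H and |X_{C̄}| ≤ δ·e(H), where X_{C̄} = {A ∈ E(H) : all r-subsets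 of A are edges of the complement of C}. -/
open Finset

/-- An edge all of whose `r`-subsets satisfy `Q` gives a copy of `K_s^{(r)}` with edges in `Q`
in the primal `r`-graph. -/
theorem hasCopyWith_completeHG_primal {r s : ℕ} {H : HGraph s} {Q : Finset ℕ → Prop}
    {A : Finset ℕ} (hA : A ∈ H.edges) (hQ : ∀ B ∈ A.powersetCard r, Q B) :
    HasCopyWith (completeHG r s) (primal r H) Q := by
  obtain ⟨φ, hφ⟩ := (Finset.range s).finite_toSet.exists_bijOn_of_encard_eq
    (t := (A : Set ℕ)) (by rw [Set.encard_coe_eq_coe_finsetCard, Set.encard_coe_eq_coe_finsetCard,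
      Finset.card_range, H.edge_card A hA])
  refine ⟨φ, hφ.injOn, fun v hv => H.edge_sub A hA (hφ.mapsTo hv), fun e he => ?_⟩
  obtain ⟨hsub, hcard⟩ := Finset.mem_powersetCard.mp he
  have himage : e.image φ ∈ A.powersetCard r := by
    refine Finset.mem_powersetCard.mpr ⟨?_, ?_⟩
    · exact Finset.image_subset_iff.mpr fun v hv => hφ.mapsTo (hsub hv)
    · rw [Finset.card_image_of_injOn (hφ.injOn.mono (Finset.coe_subset.mpr hsub)), hcard]
  exact ⟨Finset.mem_biUnion.mpr ⟨A, hA, himage⟩, hQ _ himage⟩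

open Classical in
/-- Claim: change of events. -/
theorem change_events (r s n : ℕ) (hr : 2 ≤ r) (hs : r < s)
    (F : HGraph r) (hF : 2 ≤ F.edges.card) (δ : ℝ) (hδ : 0 < δ)
    (hcol : ∀ c : Finset ℕ → Bool,
      δ * (n : ℝ) ^ s ≤
          (copyCountWith (completeHG r s) (completeHG r n) (fun e => c e = true) : ℝ) ∨
      δ * (n : ℝ) ^ F.verts.card ≤
          (copyCountWith F (completeHG r n) (fun e => c e = false) : ℝ))
    (S : Set (HGraph r)) (C : HGraph r → HGraph r)
    (hCv : ∀ s' ∈ S, (C s').verts = Finset.range n)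
    (hcont : ∀ s' ∈ S, (copyCount F (C s') : ℝ) < δ * (n : ℝ) ^ F.verts.card)
    (hfree : ∀ G : HGraph r, G.verts = Finset.range n → ¬ HasCopy F G →
      ∃ s' ∈ S, s'.edges ⊆ G.edges ∧ G.edges ⊆ (C s').edges)
    (H : HGraph s) (hH : H.verts = Finset.range n)
    (H0 : HGraph s) (hH0v : H0.verts = Finset.range n) (hH0e : H0.edges ⊆ H.edges)
    (hsize : (1 - δ) * (H.edges.card : ℝ) ≤ (H0.edges.card : ℝ))
    (hnot : ¬ Arrows2 (primal r H0) (completeHG r s) F) :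
    ∃ s' ∈ S, s'.edges ⊆ (C s').edges ∧ SqSub s' H ∧
      (((H.edges.filter fun A => ∀ B ∈ A.powersetCard r, B ∉ (C s').edges).card : ℝ) ≤
        δ * (H.edges.card : ℝ)) := by
  obtain ⟨c, hc⟩ := not_forall.mp hnot
  obtain ⟨hred, hblue⟩ := not_or.mp hc
  have hpick : ∀ A ∈ H0.edges, ∃ B ∈ A.powersetCard r, c B = false := by
    intro A hA
    by_contra! h
    exact hred (hasCopyWith_completeHG_primal hA fun B hB => by simpa using h B hB)
  choose! b hb hcb using hpick
  -- One blue `r`-set is kept for each edge of `H0`.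
  let G : HGraph r :=
    { verts := Finset.range n
      edges := H0.edges.image b
      edge_sub := by
        intro e he
        obtain ⟨A, hA, rfl⟩ := Finset.mem_image.mp he
        exact hH0v ▸ (Finset.mem_powersetCard.mp (hb A hA)).1.trans (H0.edge_sub A hA)
      edge_card := by
        intro e he
        obtain ⟨A, hA, rfl⟩ := Finset.mem_image.mp he
        exact (Finset.mem_powersetCard.mp (hb A hA)).2 }
  have hG : ¬ HasCopy F G := by
    rintro ⟨φ, hinj, hv, he⟩
    refine hblue ⟨φ, hinj, fun v hvF => hH0v.symm ▸ hv v hvF, fun e heF => ?_⟩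
    obtain ⟨A, hA, hAe⟩ := Finset.mem_image.mp (he e heF).1
    rw [← hAe]
    exact ⟨Finset.mem_biUnion.mpr ⟨A, hA, hb A hA⟩, hcb A hA⟩
  obtain ⟨T, hT, hTG, hGC⟩ := hfree G rfl hG
  refine ⟨T, hT, hTG.trans hGC, ?_, ?_⟩
  · have hex : ∀ e ∈ T.edges, ∃ A ∈ H0.edges, b A = e :=
      fun e he => Finset.mem_image.mp (hTG he)
    choose! f hf hbf using hex
    refine ⟨f, fun e he e' he' h => ?_, fun e he => ⟨hH0e (hf e he), ?_⟩⟩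
    · rw [← hbf e he, ← hbf e' he', h]
    · have hsub := (Finset.mem_powersetCard.mp (hb (f e) (hf e he))).1
      rwa [hbf e he] at hsub
  · have hsub : (H.edges.filter fun A => ∀ B ∈ A.powersetCard r, B ∉ (C T).edges) ⊆
        H.edges \ H0.edges := by
      intro A hA
      obtain ⟨hAH, hAC⟩ := Finset.mem_filter.mp hA
      exact Finset.mem_sdiff.mpr ⟨hAH, fun hA0 =>
        hAC _ (hb A hA0) (hGC (Finset.mem_image_of_mem b hA0))⟩
    have hle : ((H.edges.filter fun A => ∀ B ∈ A.powersetCard r, B ∉ (C T).edges).card : ℝ) ≤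
        ((H.edges \ H0.edges).card : ℝ) := by
      exact_mod_cast Finset.card_le_card hsub
    have hadd : ((H.edges \ H0.edges).card : ℝ) + (H0.edges.card : ℝ) = H.edges.card := by
      exact_mod_cast Finset.card_sdiff_add_card_eq_card hH0e
    linarith
end

section
/- Let t > r ≥ 2 be integers and let W be a set of t elements. If 𝓔 ⊆ 2^W is a minimal non-trivial r-cover of W, then (|𝓔|−1)·(r − 1/m_r(K^{(r)}_t)) − Σ_{A∈𝓔}|A| ≤ −t. -/
open Finset

theorem choose_add_sub_one_le (q a : ℕ) :
    ((a + (q + 1)).choose (q + 1) : ℝ) - 1 ≤ a * ((a + (q + 1)).choose q : ℝ) := by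
  induction a with
  | zero => simp
  | succ a ih =>
    have h1 : (a + 1 + (q + 1)).choose (q + 1)
        = (a + (q + 1)).choose q + (a + (q + 1)).choose (q + 1) := by
      rw [show a + 1 + (q + 1) = (a + (q + 1)) + 1 by ring, Nat.choose_succ_succ]
    have h2 : ((a + (q + 1)).choose q : ℝ) ≤ ((a + 1 + (q + 1)).choose q : ℝ) := by
      exact_mod_cast Nat.choose_le_choose q (by omega)
    have h3 := mul_le_mul_of_nonneg_left h2 (by positivity : (0 : ℝ) ≤ a + 1)
    rw [h1]
    push_cast
    linarith

theorem choose_add_sub_one_mul_le (q : ℕ) {a n : ℕ} (han : a ≤ n) :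
    (((a + (q + 1)).choose (q + 1) : ℝ) - 1) * n
      ≤ (((n + (q + 1)).choose (q + 1) : ℝ) - 1) * a := by
  induction n, han using Nat.le_induction with
  | base => rfl
  | succ n han ih =>
    have h1 : (n + 1 + (q + 1)).choose (q + 1)
        = (n + (q + 1)).choose q + (n + (q + 1)).choose (q + 1) := by
      rw [show n + 1 + (q + 1) = (n + (q + 1)) + 1 by ring, Nat.choose_succ_succ]
    have h2 : ((a + (q + 1)).choose q : ℝ) ≤ ((n + (q + 1)).choose q : ℝ) := by
      exact_mod_cast Nat.choose_le_choose q (by omega)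
    have h3 := mul_le_mul_of_nonneg_left h2 (by positivity : (0 : ℝ) ≤ a)
    have h4 := choose_add_sub_one_le q a
    rw [h1]
    push_cast
    linarith

/-- The ratio `(C(s,r) - 1) / (s - r)` is nondecreasing in `s`, in cross-multiplied form. -/
theorem choose_sub_one_mul_le {r s t : ℕ} (hr : 0 < r) (hrs : r ≤ s) (hst : s ≤ t) :
    ((s.choose r : ℝ) - 1) * ((t : ℝ) - r) ≤ ((t.choose r : ℝ) - 1) * ((s : ℝ) - r) := by
  obtain ⟨q, rfl⟩ : ∃ q, r = q + 1 := ⟨r - 1, by omega⟩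
  obtain ⟨a, rfl⟩ := Nat.exists_eq_add_of_le' hrs
  obtain ⟨n, rfl⟩ := Nat.exists_eq_add_of_le' (hrs.trans hst)
  simpa using choose_add_sub_one_mul_le q (show a ≤ n by omega)

theorem one_lt_choose {r t : ℕ} (hr : 0 < r) (hrt : r < t) : 1 < t.choose r := by
  have h := Nat.choose_le_choose r (show r + 1 ≤ t from hrt)
  rw [Nat.choose_succ_self_right] at h
  omega

theorem mDensity_completeHG {r t : ℕ} (hr : 0 < r) (hrt : r < t) :
    mDensity r (completeHG r t) = ((t.choose r : ℝ) - 1) / ((t : ℝ) - r) := by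
  have hcard : (completeHG r t).edges.card = t.choose r := by simp [completeHG]
  have h1 := one_lt_choose hr hrt
  have htr : (0 : ℝ) < (t : ℝ) - r := sub_pos.mpr (by exact_mod_cast hrt)
  rw [mDensity, if_neg (by omega), if_neg (by omega)]
  refine IsGreatest.csSup_eq ⟨⟨completeHG r t, ⟨subset_rfl, subset_rfl⟩, ?_, ?_⟩, ?_⟩
  · simpa [completeHG] using hrt
  · simp [completeHG]
  · rintro x ⟨J, hJ, hv, rfl⟩
    have hst : J.verts.card ≤ t := by
      simpa [completeHG] using card_le_card hJ.1
    have he : J.edges.card ≤ J.verts.card.choose r := by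
      rw [← card_powersetCard]
      exact card_le_card fun e he => mem_powersetCard.mpr ⟨J.edge_sub e he, J.edge_card e he⟩
    have he' : (J.edges.card : ℝ) ≤ (J.verts.card.choose r : ℝ) := by exact_mod_cast he
    have hsr : (0 : ℝ) < (J.verts.card : ℝ) - r := sub_pos.mpr (by exact_mod_cast hv)
    rw [div_le_div_iff₀ hsr htr]
    exact (mul_le_mul_of_nonneg_right (sub_le_sub_right he' 1) htr.le).trans
      (choose_sub_one_mul_le hr hv.le hst)

theorem MinNontrivCover.le_card {r : ℕ} {W : Finset ℕ} {E : Finset (Finset ℕ)}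
    (h : MinNontrivCover r W E) {A : Finset ℕ} (hA : A ∈ E) : r ≤ A.card := by
  by_contra! hlt
  refine h.2.2 (E.erase A) (erase_ssubset hA) fun B hB => ?_
  obtain ⟨C, hC, hBC⟩ := h.1 B hB
  refine ⟨C, mem_erase.mpr ⟨?_, hC⟩, hBC⟩
  rintro rfl
  have := card_le_card hBC
  rw [(mem_powersetCard.mp hB).2] at this
  omega

theorem IsRCover.choose_le_sum {r : ℕ} {W : Finset ℕ} {E : Finset (Finset ℕ)}
    (h : IsRCover r W E) : W.card.choose r ≤ ∑ A ∈ E, A.card.choose r := by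
  calc W.card.choose r = (W.powersetCard r).card := (card_powersetCard r W).symm
    _ ≤ (E.biUnion fun A => A.powersetCard r).card := by
      refine card_le_card fun B hB => ?_
      obtain ⟨A, hA, hBA⟩ := h B hB
      exact mem_biUnion.mpr ⟨A, hA, mem_powersetCard.mpr ⟨hBA, (mem_powersetCard.mp hB).2⟩⟩
    _ ≤ ∑ A ∈ E, (A.powersetCard r).card := card_biUnion_le
    _ = ∑ A ∈ E, A.card.choose r := by simp

/-- Lemma: bound for minimal non-trivial `r`-covers. -/
theorem bound_r_cover (r t : ℕ) (hr : 2 ≤ r) (hrt : r < t)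
    (W : Finset ℕ) (hW : W.card = t)
    (E : Finset (Finset ℕ)) (hE : ∀ A ∈ E, A ⊆ W) (hmin : MinNontrivCover r W E) :
    ((E.card : ℝ) - 1) * ((r : ℝ) - 1 / mDensity r (completeHG r t)) -
        ∑ A ∈ E, (A.card : ℝ) ≤ -(t : ℝ) := by
  have hr0 : 0 < r := by omega
  have hM : (0 : ℝ) < (t.choose r : ℝ) - 1 :=
    sub_pos.mpr (by exact_mod_cast one_lt_choose hr0 hrt)
  have htr : (0 : ℝ) < (t : ℝ) - r := sub_pos.mpr (by exact_mod_cast hrt)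
  have hsum : ∑ A ∈ E, ((A.card.choose r : ℝ) - 1) * ((t : ℝ) - r)
      ≤ ∑ A ∈ E, ((t.choose r : ℝ) - 1) * ((A.card : ℝ) - r) :=
    sum_le_sum fun A hA => choose_sub_one_mul_le hr0 (hmin.le_card hA)
      (hW ▸ card_le_card (hE A hA))
  rw [← sum_mul, ← mul_sum, sum_sub_distrib, sum_sub_distrib] at hsum
  simp only [sum_const, nsmul_eq_mul, mul_one] at hsum
  have hcov : (t.choose r : ℝ) ≤ ∑ A ∈ E, (A.card.choose r : ℝ) := by
    exact_mod_cast hW ▸ hmin.1.choose_le_sum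
  have hmul := (mul_le_mul_of_nonneg_right (sub_le_sub_right hcov (E.card : ℝ)) htr.le).trans hsum
  rw [mDensity_completeHG hr0 hrt, one_div_div]
  have hdiv : ((t : ℝ) - r) * ((t.choose r : ℝ) - E.card) / ((t.choose r : ℝ) - 1)
      ≤ ∑ A ∈ E, (A.card : ℝ) - E.card * r := by
    rw [div_le_iff₀ hM]
    linarith
  have hid : ((t : ℝ) - r) * ((t.choose r : ℝ) - E.card) / ((t.choose r : ℝ) - 1)
      = ((t : ℝ) - r) - (E.card - 1) * (((t : ℝ) - r) / ((t.choose r : ℝ) - 1)) := by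
    field_simp
    ring
  linarith
end

section
/- Let r,ℓ ≥ 2 and t_1 ≥ … ≥ t_ℓ > r be integers, let s be an integer with K^{(r)}_s ↛ (K^{(r)}_{t_1},…,K^{(r)}_{t_ℓ}) (e.g., s = R(K^{(r)}_{t_1},…,K^{(r)}_{t_ℓ}) − 1), and let H_0 be an s-uniform hypergraph that is r-linear and (r,t_ℓ)-conformal. Then G[H_0,r] ↛ (K^{(r)}_{t_1},…,K^{(r)}_{t_ℓ}). -/
open Finset

/-- In an `r`-linear `(r,t)`-conformal hypergraph with `r < t`, every clique of the primal
`r`-graph on at least `t` vertices is contained in an edge. -/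
theorem exists_edge_superset_of_clique {r t s : ℕ} (hrt : r < t) {H : HGraph s}
    (hlin : RLinear r H) (hconf : HGConformal r t H) {W : Finset ℕ} (hW : W ⊆ H.verts)
    (hcard : t ≤ W.card) (hclique : ∀ B ∈ W.powersetCard r, B ∈ (primal r H).edges) :
    ∃ A ∈ H.edges, W ⊆ A := by
  have hsub : ∀ U ⊆ W, U.card = t → ∃ A ∈ H.edges, U ⊆ A := fun U hU hUt =>
    hconf U (hU.trans hW) hUt fun B hB => hclique B (powersetCard_mono hU hB)
  obtain ⟨U, hUW, hUt⟩ := exists_subset_card_eq hcard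
  obtain ⟨A, hA, hUA⟩ := hsub U hUW hUt
  refine ⟨A, hA, fun v hv => ?_⟩
  by_cases hvU : v ∈ U
  · exact hUA hvU
  obtain ⟨T, hTU, hTt⟩ := exists_subset_card_eq (s := U) (n := t - 1) (by omega)
  have hvT : v ∉ T := fun h => hvU (hTU h)
  obtain ⟨A', hA', hTA'⟩ := hsub (insert v T) (insert_subset hv (hTU.trans hUW))
    (by rw [card_insert_of_notMem hvT]; omega)
  obtain ⟨B, hBT, hBr⟩ := exists_subset_card_eq (s := T) (n := r) (by omega)
  have hAA' : A = A' := hlin A hA A' hA' B hBr (hBT.trans (hTU.trans hUA))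
    (hBT.trans ((subset_insert v T).trans hTA'))
  exact hAA' ▸ hTA' (mem_insert_self v T)

/-- The edges of an `s`-graph can be simultaneously labelled injectively by `0, …, s-1`. -/
theorem exists_edge_labelling {s : ℕ} (H : HGraph s) :
    ∃ g : Finset ℕ → ℕ → ℕ, ∀ A ∈ H.edges,
      Set.InjOn (g A) ↑A ∧ ∀ v ∈ A, g A v ∈ range s := by
  have h : ∀ A : Finset ℕ, ∃ f : ℕ → ℕ, A ∈ H.edges →
      Set.InjOn f ↑A ∧ ∀ v ∈ A, f v ∈ range s := by
    intro A
    by_cases hA : A ∈ H.edges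
    · let e : A ≃ range s := equivOfCardEq (by rw [H.edge_card A hA, card_range])
      refine ⟨fun v => if h : v ∈ A then e ⟨v, h⟩ else 0, fun _ => ⟨?_, ?_⟩⟩
      · intro v hv w hw hvw
        rw [mem_coe] at hv hw
        simp only [hv, hw, dite_true] at hvw
        exact congrArg Subtype.val (e.injective (Subtype.ext hvw))
      · intro v hv
        simp only [hv, dite_true]
        exact (e ⟨v, hv⟩).2
    · exact ⟨id, fun h => absurd h hA⟩
  choose g hg using h
  exact ⟨g, hg⟩

/-- if `K_s^{(r)} ↛ (K_{t_1}^{(r)}, …, K_{t_ℓ}^{(r)})` and `H₀` is an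
`r`-linear `(r,t_ℓ)`-conformal `s`-graph, then `G[H₀,r] ↛ (K_{t_1}^{(r)}, …, K_{t_ℓ}^{(r)})`. -/
theorem primal_not_ramsey (r l s : ℕ) (hr : 2 ≤ r) (hl : 2 ≤ l) (t : Fin l → ℕ)
    (hdec : ∀ i j : Fin l, i ≤ j → t j ≤ t i)
    (hlr : r < t ⟨l - 1, by omega⟩)
    (hs : ¬ ArrowsList (completeHG r s) l (fun i => completeHG r (t i)))
    (H0 : HGraph s) (hlin : RLinear r H0)
    (hconf : HGConformal r (t ⟨l - 1, by omega⟩) H0) :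
    ¬ ArrowsList (primal r H0) l (fun i => completeHG r (t i)) := by
  classical
  intro harr
  apply hs
  intro c
  obtain ⟨g, hg⟩ := exists_edge_labelling H0
  let E : Finset ℕ → Finset ℕ := fun e =>
    if h : ∃ A ∈ H0.edges, e ⊆ A then h.choose else ∅
  have hE : ∀ A ∈ H0.edges, ∀ e : Finset ℕ, e.card = r → e ⊆ A → E e = A := by
    intro A hA e her heA
    have h : ∃ A ∈ H0.edges, e ⊆ A := ⟨A, hA, heA⟩
    have hEe : E e = h.choose := dif_pos h
    rw [hEe]
    exact hlin _ h.choose_spec.1 A hA e her h.choose_spec.2 heA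
  obtain ⟨i, φ, hinj, hverts, hedges⟩ := harr fun e => c (e.image (g (E e)))
  replace hinj : Set.InjOn φ ↑(range (t i)) := hinj
  replace hverts : ∀ v ∈ range (t i), φ v ∈ H0.verts := hverts
  replace hedges : ∀ e ∈ (range (t i)).powersetCard r, e.image φ ∈ (primal r H0).edges ∧
      c ((e.image φ).image (g (E (e.image φ)))) = i := hedges
  have hcopy : ∃ A ∈ H0.edges, (range (t i)).image φ ⊆ A := by
    refine exists_edge_superset_of_clique hlr hlin hconf (image_subset_iff.mpr hverts) ?_ ?_
    · rw [card_image_of_injOn hinj, card_range]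
      exact hdec _ _ (Fin.le_def.mpr (Nat.le_sub_one_of_lt i.2))
    · intro B hB
      obtain ⟨hBW, hBr⟩ := mem_powersetCard.mp hB
      obtain ⟨e, he, rfl⟩ := subset_image_iff.mp hBW
      have hinj' : Set.InjOn φ ↑e := hinj.mono he
      rw [card_image_of_injOn hinj'] at hBr
      exact (hedges e (mem_powersetCard.mpr ⟨mod_cast he, hBr⟩)).1
  obtain ⟨A, hA, hWA⟩ := hcopy
  obtain ⟨hgA, hgs⟩ := hg A hA
  have hφA : ∀ v ∈ range (t i), φ v ∈ A := fun v hv => hWA (mem_image_of_mem φ hv)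
  have hcomp : Set.InjOn (g A ∘ φ) ↑(range (t i)) := hgA.comp hinj hφA
  refine ⟨i, g A ∘ φ, hcomp, fun v hv => hgs _ (hφA v hv), fun e he => ?_⟩
  obtain ⟨hesub, her⟩ := mem_powersetCard.mp he
  refine ⟨mem_powersetCard.mpr ⟨?_, ?_⟩, ?_⟩
  · exact image_subset_iff.mpr fun v hv => hgs _ (hφA v (hesub hv))
  · rw [card_image_of_injOn (hcomp.mono (coe_subset.mpr hesub)), her]
  · have h := (hedges e he).2
    rwa [hE A hA (e.image φ)
      (by rw [card_image_of_injOn (hinj.mono (coe_subset.mpr hesub)), her])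
      ((image_subset_image hesub).trans hWA), image_image] at h
end

section
/- Let s ≥ t > r ≥ 2 be integers and let H_0 be an s-uniform hypergraph that is r-linear and (r,t)-conformal. If U ⊆ V(H_0) is a set of at least t vertices such that every r-subset of U is an edge of G[H_0,r] (i.e., U spans a clique in the primal r-graph), then there is a single edge A ∈ E(H_0) with U ⊆ A. -/
open Finset

/-- in an `r`-linear `(r,t)`-conformal `s`-graph, every clique of the
primal `r`-graph on at least `t` vertices is contained in a single edge. -/
theorem clique_in_edge (r s t : ℕ) (hr : 2 ≤ r) (hrt : r < t) (hts : t ≤ s)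
    (H0 : HGraph s) (hlin : RLinear r H0) (hconf : HGConformal r t H0)
    (U : Finset ℕ) (hU : U ⊆ H0.verts) (hcard : t ≤ U.card)
    (hclique : ∀ B ∈ U.powersetCard r, B ∈ (primal r H0).edges) :
    ∃ A ∈ H0.edges, U ⊆ A := by
  have clique_mem_edge : ∀ W ⊆ U, W.card = t → ∃ A ∈ H0.edges, W ⊆ A := fun W hWU hWt =>
    hconf W (hWU.trans hU) hWt fun B hB => hclique B (powersetCard_mono hWU hB)
  obtain ⟨W, hWU, hWt⟩ := exists_subset_card_eq hcard
  obtain ⟨A, hA, hWA⟩ := clique_mem_edge W hWU hWt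
  refine ⟨A, hA, fun v hv => ?_⟩
  by_contra hvA
  obtain ⟨X, hXW, hXcard⟩ := exists_subset_card_eq (s := W) (n := t - 1) (by omega)
  have hvX : v ∉ X := fun h => hvA (hWA (hXW h))
  obtain ⟨A', hA', hXA'⟩ := clique_mem_edge (insert v X)
    (insert_subset hv (hXW.trans hWU)) (by rw [card_insert_of_notMem hvX]; omega)
  obtain ⟨e, heX, he⟩ := exists_subset_card_eq (s := X) (n := r) (by omega)
  have hAA' : A = A' := hlin A hA A' hA' e he (heX.trans (hXW.trans hWA))
    (heX.trans ((subset_insert v X).trans hXA'))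
  exact hvA (hAA' ▸ hXA' (mem_insert_self v X))
end

section
/- Let s ≥ t > r ≥ 2 be integers and let H be a finite s-uniform hypergraph. Let X be the number of pairs (W,𝓔) where W is a t-element subset of V(H) and 𝓔 ⊆ E(H) is a minimal non-trivial r-cover of W, and let Y be the number of pairs {A_1,A_2} of distinct edges of H with |A_1 ∩ A_2| ≥ r. Then there exists a spanning subhypergraph H_0 ⊆ H that is r-linear and (r,t)-conformal with e(H_0) ≥ e(H) − X − Y. -/
open Finset

/-- A finite family of nonempty finite sets has a transversal at most as large as the family,
where the family is indexed by a finset. -/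
theorem exists_hitting_set {ι α : Type*} [DecidableEq α] (I : Finset ι) (F : ι → Finset α)
    (hF : ∀ i ∈ I, (F i).Nonempty) :
    ∃ D : Finset α, D.card ≤ I.card ∧ ∀ i ∈ I, ∃ x ∈ F i, x ∈ D := by
  choose f hf using hF
  refine ⟨I.attach.image fun i => f i.1 i.2, ?_, fun i hi => ⟨f i hi, hf i hi, ?_⟩⟩
  · exact card_image_le.trans_eq card_attach
  · exact mem_image.mpr ⟨⟨i, hi⟩, mem_attach _ _, rfl⟩

theorem IsRCover.nonempty {r : ℕ} {W : Finset ℕ} {E : Finset (Finset ℕ)} (h : IsRCover r W E)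
    (hr : r ≤ W.card) : E.Nonempty := by
  obtain ⟨B, hB⟩ := powersetCard_nonempty.mpr hr
  obtain ⟨A, hA, -⟩ := h B hB
  exact ⟨A, hA⟩

/-- Every `r`-cover contains one that is minimal under inclusion. -/
theorem IsRCover.exists_minimal_subset {r : ℕ} {W : Finset ℕ} {E : Finset (Finset ℕ)}
    (h : IsRCover r W E) :
    ∃ E' ⊆ E, IsRCover r W E' ∧ ∀ E'' ⊂ E', ¬ IsRCover r W E'' := by
  induction E using Finset.strongInduction with
  | H E ih =>
    by_cases hE : ∃ E' ⊂ E, IsRCover r W E'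
    · obtain ⟨E', hE', hc⟩ := hE
      obtain ⟨E'', hsub, hmin⟩ := ih E' hE' hc
      exact ⟨E'', hsub.trans hE'.subset, hmin⟩
    · exact ⟨E, Subset.rfl, h, fun E' hE' hc => hE ⟨E', hE', hc⟩⟩

theorem IsRCover.subset_of_singleton {r : ℕ} {W A : Finset ℕ} (h : IsRCover r W {A})
    (hr : 1 ≤ r) (hrW : r ≤ W.card) : W ⊆ A := by
  intro w hw
  obtain ⟨B, hwB, hBW, hB⟩ := exists_subsuperset_card_eq (singleton_subset_iff.mpr hw)
    (by simpa using hr) hrW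
  obtain ⟨A', hA', hBA⟩ := h B (mem_powersetCard.mpr ⟨hBW, hB⟩)
  rw [mem_singleton.mp hA'] at hBA
  exact hBA (singleton_subset_iff.mp hwB)

open Classical in
/-- deleting one edge from each minimal non-trivial cover and each
`r`-intersecting pair leaves an `r`-linear `(r,t)`-conformal spanning subhypergraph. -/
theorem linear_conformal_sub (r s t : ℕ) (hr : 2 ≤ r) (hrt : r < t) (hts : t ≤ s)
    (H : HGraph s) :
    ∃ H0 : HGraph s, H0.verts = H.verts ∧ H0.edges ⊆ H.edges ∧
      RLinear r H0 ∧ HGConformal r t H0 ∧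
      (H.edges.card : ℤ) -
          (((H.verts.powersetCard t ×ˢ H.edges.powerset).filter
              fun P => MinNontrivCover r P.1 P.2).card : ℤ) -
          (((H.edges.powersetCard 2).filter
              fun P => ∃ A1 ∈ P, ∃ A2 ∈ P, A1 ≠ A2 ∧ r ≤ (A1 ∩ A2).card).card : ℤ) ≤
        (H0.edges.card : ℤ) := by
  set X := (H.verts.powersetCard t ×ˢ H.edges.powerset).filter
    fun P => MinNontrivCover r P.1 P.2 with hX
  set Y := (H.edges.powersetCard 2).filter
    fun P => ∃ A1 ∈ P, ∃ A2 ∈ P, A1 ≠ A2 ∧ r ≤ (A1 ∩ A2).card with hY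
  obtain ⟨D₁, hD₁, hit₁⟩ := exists_hitting_set X (fun P => P.2) (by
    intro P hP
    simp only [hX, mem_filter, mem_product, mem_powersetCard] at hP
    exact hP.2.1.nonempty (hP.1.1.2 ▸ hrt.le))
  obtain ⟨D₂, hD₂, hit₂⟩ := exists_hitting_set Y id (by
    intro P hP
    obtain ⟨A, hA, -⟩ := (mem_filter.mp hP).2
    exact ⟨A, hA⟩)
  have hsub : H.edges \ (D₁ ∪ D₂) ⊆ H.edges := sdiff_subset
  refine ⟨⟨H.verts, H.edges \ (D₁ ∪ D₂), fun e he => H.edge_sub e (hsub he),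
    fun e he => H.edge_card e (hsub he)⟩, rfl, hsub, ?_, ?_, ?_⟩
  · intro A hA B hB e he heA heB
    by_contra hAB
    have hmem : ({A, B} : Finset (Finset ℕ)) ∈ Y := by
      refine mem_filter.mpr ⟨mem_powersetCard.mpr ⟨?_, card_pair hAB⟩,
        A, by simp, B, by simp, hAB, he ▸ card_le_card (subset_inter heA heB)⟩
      simpa [insert_subset_iff] using ⟨hsub hA, hsub hB⟩
    obtain ⟨x, hx, hxD⟩ := hit₂ _ hmem
    have hxE : x ∈ H.edges \ (D₁ ∪ D₂) := by
      rcases mem_insert.mp hx with rfl | hx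
      · exact hA
      · exact mem_singleton.mp hx ▸ hB
    exact (mem_sdiff.mp hxE).2 (mem_union_right _ hxD)
  · intro W hW hWt hcl
    have hcov : IsRCover r W (H.edges \ (D₁ ∪ D₂)) := by
      intro B hB
      obtain ⟨A, hA, hBA⟩ := mem_biUnion.mp (hcl B hB)
      exact ⟨A, hA, (mem_powersetCard.mp hBA).1⟩
    obtain ⟨E, hE, hEc, hEmin⟩ := hcov.exists_minimal_subset
    by_cases hcard : E.card = 1
    · obtain ⟨A, rfl⟩ := card_eq_one.mp hcard
      exact ⟨A, hE (mem_singleton_self A),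
        hEc.subset_of_singleton (by omega) (hWt ▸ hrt.le)⟩
    · have hmem : (W, E) ∈ X := mem_filter.mpr ⟨mem_product.mpr
        ⟨mem_powersetCard.mpr ⟨hW, hWt⟩, mem_powerset.mpr (hE.trans hsub)⟩,
        hEc, hcard, hEmin⟩
      obtain ⟨x, hx, hxD⟩ := hit₁ _ hmem
      exact absurd (mem_union_left _ hxD) (mem_sdiff.mp (hE hx)).2
  · have h₁ := le_card_sdiff (D₁ ∪ D₂) H.edges
    have h₂ := card_union_le D₁ D₂
    dsimp only
    omega
end
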